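/- Let (A, φ) be a C*-probability space with φ a faithful tracial state, and let X, Y ∈ A be free, with X free Poisson distributed with parameters (λ, α) and Y free Poisson distributed with parameters (κ, α), where λ + κ > 1, α > 0. Then the random variables U = (X+Y)^{-1/2} X (X+Y)^{-1/2} and V = X + Y are free. -/

import Mathlib

open scoped Classical
open Finset

noncomputable section

namespace FreeProbLukacs

variable {A : Type*}

/-- Ordered (non-commutative) product of a tuple. -/
def tprod [Monoid A] {n : ℕ} (X : Fin n → A) : A := (List.ofFn X).prod

/-- `P` is a partition of `Fin n`: a finset of nonempty blocks, each point in a unique block. -/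
def IsPartition {n : ℕ} (P : Finset (Finset (Fin n))) : Prop :=
  (∀ B ∈ P, B.Nonempty) ∧ ∀ i : Fin n, ∃! B, B ∈ P ∧ i ∈ B

/-- `P` is non-crossing: there are no `a < b < c < d` with `a, c` in one block and
`b, d` in a different block. -/
def IsNonCrossing {n : ℕ} (P : Finset (Finset (Fin n))) : Prop :=
  ∀ B₁ ∈ P, ∀ B₂ ∈ P, ∀ a ∈ B₁, ∀ b ∈ B₂, ∀ c ∈ B₁, ∀ d ∈ B₂,
    a < b → b < c → c < d → B₁ = B₂

/-- The finset of all non-crossing partitions of `Fin n`. -/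
def NC (n : ℕ) : Finset (Finset (Finset (Fin n))) :=
  univ.filter fun P => IsPartition P ∧ IsNonCrossing P

/-- The cumulant functional `R` applied to the entries of `X` lying in a block `B`,
taken in increasing order of position. -/
def blockCum (R : ∀ n, (Fin n → A) → ℂ) {n : ℕ} (X : Fin n → A) (B : Finset (Fin n)) : ℂ :=
  R B.card fun j => X ((B.sort (· ≤ ·)).get (Fin.cast (Finset.length_sort (· ≤ ·)).symm j))

/-- Product of block cumulants over the blocks of a partition. -/
def partCum (R : ∀ n, (Fin n → A) → ℂ) {n : ℕ} (X : Fin n → A)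
    (P : Finset (Finset (Fin n))) : ℂ :=
  ∏ B ∈ P, blockCum R X B

/-- The moment–cumulant formula: `R` is the family of free cumulants of `φ`. -/
def MomentCumulant [Monoid A] (φ : A → ℂ) (R : ∀ n, (Fin n → A) → ℂ) : Prop :=
  ∀ (n : ℕ) (X : Fin n → A), φ (tprod X) = ∑ P ∈ NC n, partCum R X P

/-- Density of the absolutely continuous part of the Marchenko–Pastur law. -/
def freePoissonDensity (l a x : ℝ) : ℝ :=
  Real.sqrt (4 * l * a ^ 2 - (x - a * (1 + l)) ^ 2) / (2 * Real.pi * a * x)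

/-- The free Poisson (Marchenko–Pastur) distribution with rate `l` and jump size `a`. -/
def freePoissonMeasure (l a : ℝ) : MeasureTheory.Measure ℝ :=
  ENNReal.ofReal (max 0 (1 - l)) • MeasureTheory.Measure.dirac 0 +
    MeasureTheory.volume.withDensity fun x => ENNReal.ofReal (freePoissonDensity l a x)

/-- `X` has distribution `μ` in the sense of moments. -/
def HasMoments [Monoid A] (φ : A → ℂ) (X : A) (μ : MeasureTheory.Measure ℝ) : Prop :=
  ∀ r : ℕ, φ (X ^ r) = ((∫ t, t ^ r ∂μ : ℝ) : ℂ)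

/-- `φ` is a state: unital and positive. -/
def IsState [Ring A] [StarRing A] [Module ℂ A] (φ : A →ₗ[ℂ] ℂ) : Prop :=
  φ 1 = 1 ∧ ∀ a : A, ∃ r : ℝ, 0 ≤ r ∧ φ (star a * a) = (r : ℂ)

/-- `φ` is faithful. -/
def Faithful [Ring A] [StarRing A] [Module ℂ A] (φ : A →ₗ[ℂ] ℂ) : Prop :=
  ∀ a : A, φ (star a * a) = 0 → a = 0

/-- `φ` is tracial. -/
def Tracial [Ring A] [Module ℂ A] (φ : A →ₗ[ℂ] ℂ) : Prop :=
  ∀ a b : A, φ (a * b) = φ (b * a)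

/-- All mixed cumulants with entries from `S` and from `T` vanish. -/
def MixedVanish (R : ∀ n, (Fin n → A) → ℂ) (S T : Set A) : Prop :=
  ∀ (n : ℕ) (f : Fin n → A), (∀ i, f i ∈ S ∪ T) → (∃ i, f i ∈ S) → (∃ j, f j ∈ T) →
    R n f = 0

/-- Two elements are free: all their mixed free cumulants vanish. -/
def FreeElems (R : ∀ n, (Fin n → A) → ℂ) (x y : A) : Prop :=
  MixedVanish R {x} {y}

/-- Interleaving of a partition `P` (placed at positions `1,2,…,n`, i.e. evens)
and `Q` (placed at positions `1̄,…,n̄`, i.e. odds) inside `Fin (2 * n)`. -/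
def interleave {n : ℕ} (P Q : Finset (Finset (Fin n))) : Finset (Finset (Fin (2 * n))) :=
  P.image (fun B => B.image fun i => (⟨2 * i.1, by have := i.isLt; omega⟩ : Fin (2 * n)))
    ∪ Q.image (fun B => B.image fun i => (⟨2 * i.1 + 1, by have := i.isLt; omega⟩ : Fin (2 * n)))

/-- `Q` refines ... : every block of `P` is contained in a block of `Q`. -/
def Refines {n : ℕ} (P Q : Finset (Finset (Fin n))) : Prop :=
  ∀ B ∈ P, ∃ C ∈ Q, B ⊆ C

/-- `Q` is the Kreweras complement of `P`: the largest partition whose interleaving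
with `P` is non-crossing. -/
def IsKrewerasComplement {n : ℕ} (P Q : Finset (Finset (Fin n))) : Prop :=
  IsPartition Q ∧ IsNonCrossing (interleave P Q) ∧
    ∀ Q', IsPartition Q' → IsNonCrossing (interleave P Q') → Refines Q' Q

end FreeProbLukacs
namespace FreeProbLukacs

/-- `P` is a non-crossing partition of the finite set `s` of natural numbers. -/
structure IsNCPartition (s : Finset ℕ) (P : Finset (Finset ℕ)) : Prop where
  nonempty : ∀ B ∈ P, B.Nonempty
  subset : ∀ B ∈ P, B ⊆ s
  cover : ∀ x ∈ s, ∃ B ∈ P, x ∈ B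
  disj : ∀ B ∈ P, ∀ C ∈ P, ∀ x ∈ B, x ∈ C → B = C
  noncrossing : ∀ B ∈ P, ∀ C ∈ P, ∀ a ∈ B, ∀ b ∈ C, ∀ c ∈ B, ∀ d ∈ C,
    a < b → b < c → c < d → B = C

/-- The non-crossing partitions of `s`. -/
def ncPartitions (s : Finset ℕ) : Finset (Finset (Finset ℕ)) :=
  s.powerset.powerset.filter (IsNCPartition s)

theorem mem_ncPartitions {s : Finset ℕ} {P : Finset (Finset ℕ)} :
    P ∈ ncPartitions s ↔ IsNCPartition s P := by
  simp only [ncPartitions, mem_filter, mem_powerset, and_iff_right_iff_imp]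
  exact fun h B hB => mem_powerset.2 (h.subset B hB)

/-- The sum over the non-crossing partitions of `s` of the products of the weights of the
blocks. -/
def ncSum (k : Finset ℕ → ℂ) (s : Finset ℕ) : ℂ := ∑ P ∈ ncPartitions s, ∏ B ∈ P, k B

theorem ncSum_congr {k k' : Finset ℕ → ℂ} {s : Finset ℕ}
    (h : ∀ B ⊆ s, B.Nonempty → k B = k' B) : ncSum k s = ncSum k' s := by
  refine sum_congr rfl fun P hP => prod_congr rfl fun B hB => ?_
  rw [mem_ncPartitions] at hP
  exact h B (hP.subset B hB) (hP.nonempty B hB)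

theorem singleton_mem_ncPartitions {s : Finset ℕ} (hs : s.Nonempty) : {s} ∈ ncPartitions s := by
  rw [mem_ncPartitions]
  constructor <;> simp_all

/-- A family of block weights is determined by its non-crossing sums. -/
theorem eq_of_ncSum_eq {k k' : Finset ℕ → ℂ} {s : Finset ℕ} (hs : s.Nonempty)
    (h : ∀ t ⊆ s, ncSum k t = ncSum k' t) : k s = k' s := by
  induction s using Finset.strongInduction with
  | H s ih =>
    have key : ∑ P ∈ (ncPartitions s).erase {s}, ∏ B ∈ P, k B =
        ∑ P ∈ (ncPartitions s).erase {s}, ∏ B ∈ P, k' B := by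
      refine sum_congr rfl fun P hP => prod_congr rfl fun B hB => ?_
      obtain ⟨hne, hP⟩ := mem_erase.1 hP
      rw [mem_ncPartitions] at hP
      have hBs : B ⊂ s := by
        refine (hP.subset B hB).ssubset_of_ne ?_
        rintro rfl
        refine hne (eq_singleton_iff_unique_mem.2 ⟨hB, fun C hC => ?_⟩)
        obtain ⟨x, hx⟩ := hP.nonempty C hC
        exact hP.disj C hC B hB x hx (hP.subset C hC hx)
      exact ih B hBs (hP.nonempty B hB) fun t ht => h t (ht.trans hBs.subset)
    have := h s subset_rfl
    rw [ncSum, ncSum, ← add_sum_erase _ _ (singleton_mem_ncPartitions hs),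
      ← add_sum_erase _ _ (singleton_mem_ncPartitions hs), key] at this
    simpa using this

theorem sum_singleton_mem (k : Finset ℕ → ℂ) {s : Finset ℕ} {p : ℕ} (hp : p ∈ s) :
    ∑ P ∈ ncPartitions s with {p} ∈ P, ∏ B ∈ P, k B = k {p} * ncSum k (s.erase p) := by
  rw [ncSum, mul_sum]
  symm
  have aux : ∀ P ∈ ncPartitions (s.erase p), {p} ∉ P := by
    intro P hP h
    have := (mem_ncPartitions.1 hP).subset _ h
    simp at this
  refine sum_nbij' (fun P => insert {p} P) (fun P => P.erase {p}) ?_ ?_ ?_ ?_ ?_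
  · intro P hP
    rw [mem_ncPartitions] at hP
    simp only [mem_filter, mem_insert_self, and_true, mem_ncPartitions]
    obtain ⟨h1, h2, h3, h4, h5⟩ := hP
    constructor
    · simp only [mem_insert]
      rintro B (rfl | hB)
      exacts [singleton_nonempty p, h1 B hB]
    · simp only [mem_insert]
      rintro B (rfl | hB)
      exacts [by simpa using hp, (h2 B hB).trans (erase_subset _ _)]
    · intro x hx
      by_cases hxp : x = p
      · exact ⟨{p}, mem_insert_self _ _, by simpa using hxp⟩
      · obtain ⟨B, hB, hxB⟩ := h3 x (mem_erase.2 ⟨hxp, hx⟩)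
        exact ⟨B, mem_insert_of_mem hB, hxB⟩
    · simp only [mem_insert]
      rintro B (rfl | hB) C (rfl | hC) x hxB hxC
      · rfl
      · exact absurd (h2 C hC (mem_singleton.1 hxB ▸ hxC)) (by simp)
      · exact absurd (h2 B hB (mem_singleton.1 hxC ▸ hxB)) (by simp)
      · exact h4 B hB C hC x hxB hxC
    · simp only [mem_insert]
      rintro B (rfl | hB) C (rfl | hC) a ha b hb c hc d hd hab hbc hcd
      · rfl
      · simp only [mem_singleton] at ha hc
        omega
      · simp only [mem_singleton] at hb hd
        omega
      · exact h5 B hB C hC a ha b hb c hc d hd hab hbc hcd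
  · intro P hP
    simp only [mem_filter, mem_ncPartitions] at hP
    rw [mem_ncPartitions]
    obtain ⟨⟨h1, h2, h3, h4, h5⟩, h⟩ := hP
    constructor
    · exact fun B hB => h1 B (mem_of_mem_erase hB)
    · intro B hB x hx
      refine mem_erase.2 ⟨?_, h2 B (mem_of_mem_erase hB) hx⟩
      rintro rfl
      exact (mem_erase.1 hB).1 (h4 B (mem_of_mem_erase hB) _ h x hx (mem_singleton_self x))
    · intro x hx
      obtain ⟨B, hB, hxB⟩ := h3 x (mem_of_mem_erase hx)
      refine ⟨B, mem_erase.2 ⟨?_, hB⟩, hxB⟩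
      rintro rfl
      simp_all
    · exact fun B hB C hC => h4 B (mem_of_mem_erase hB) C (mem_of_mem_erase hC)
    · exact fun B hB C hC => h5 B (mem_of_mem_erase hB) C (mem_of_mem_erase hC)
  · intro P hP
    exact erase_insert (aux P hP)
  · intro P hP
    exact insert_erase (mem_filter.1 hP).2
  · intro P hP
    rw [prod_insert (aux P hP)]

/-- `p` and `q` are neighbours in a block of `P`. -/
def Adjacent (P : Finset (Finset ℕ)) (p q : ℕ) : Prop :=
  ∃ B ∈ P, p ∈ B ∧ q ∈ B ∧ ∀ x ∈ B, ¬(p < x ∧ x < q)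

/-- Adjoin `p` to `B` when `B` contains `q`. -/
def attach (p q : ℕ) (B : Finset ℕ) : Finset ℕ := if q ∈ B then insert p B else B

theorem glue_isNCPartition {s : Finset ℕ} {p q : ℕ} (hp : p ∈ s) (hq : q ∈ s) (hpq : p < q)
    {P Q : Finset (Finset ℕ)} (hP : IsNCPartition {x ∈ s | p < x ∧ x < q} P)
    (hQ : IsNCPartition {x ∈ s | ¬(p ≤ x ∧ x < q)} Q) :
    IsNCPartition s (P ∪ Q.image (attach p q)) := by
  obtain ⟨p1, p2, p3, p4, p5⟩ := hP
  obtain ⟨q1, q2, q3, q4, q5⟩ := hQ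
  simp only [subset_iff, mem_filter] at p2 q2 p3 q3
  obtain ⟨B0, hB0, hqB0⟩ := q3 q ⟨hq, by omega⟩
  have hatt : ∀ B ∈ Q, ∀ x, x ∈ attach p q B ↔ x ∈ B ∨ (B = B0 ∧ x = p) := by
    intro B hB x
    unfold attach
    split_ifs with h
    · have := q4 B hB B0 hB0 q h hqB0
      simp [this, or_comm]
    · have : B ≠ B0 := by rintro rfl; exact h hqB0
      simp [this]
  constructor
  · simp only [mem_union, mem_image]
    rintro B (hB | ⟨B, hB, rfl⟩)
    · exact p1 B hB
    · obtain ⟨x, hx⟩ := q1 B hB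
      exact ⟨x, (hatt B hB x).2 (Or.inl hx)⟩
  · simp only [mem_union, mem_image]
    rintro B (hB | ⟨B, hB, rfl⟩) x hx
    · exact (p2 B hB hx).1
    · rcases (hatt B hB x).1 hx with h | ⟨_, rfl⟩
      · exact (q2 B hB h).1
      · exact hp
  · intro x hx
    by_cases h1 : p < x ∧ x < q
    · obtain ⟨B, hB, hxB⟩ := p3 x ⟨hx, h1⟩
      exact ⟨B, mem_union_left _ hB, hxB⟩
    by_cases h2 : x = p
    · exact ⟨_, mem_union_right _ (mem_image_of_mem _ hB0), (hatt _ hB0 x).2 (Or.inr ⟨rfl, h2⟩)⟩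
    · obtain ⟨B, hB, hxB⟩ := q3 x ⟨hx, by omega⟩
      exact ⟨_, mem_union_right _ (mem_image_of_mem _ hB), (hatt _ hB x).2 (Or.inl hxB)⟩
  · simp only [mem_union, mem_image]
    rintro B (hB | ⟨B, hB, rfl⟩) C (hC | ⟨C, hC, rfl⟩) x hxB hxC
    · exact p4 B hB C hC x hxB hxC
    · rw [hatt C hC] at hxC
      have := p2 B hB hxB
      rcases hxC with h | h
      · have := q2 C hC h
        omega
      · omega
    · rw [hatt B hB] at hxB
      have := p2 C hC hxC
      rcases hxB with h | h
      · have := q2 B hB h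
        omega
      · omega
    · rw [hatt B hB] at hxB
      rw [hatt C hC] at hxC
      have : B = C := by
        rcases hxB with h | h <;> rcases hxC with h' | h'
        · exact q4 B hB C hC x h h'
        · have := q2 B hB h
          omega
        · have := q2 C hC h'
          omega
        · rw [h.1, h'.1]
      rw [this]
  · simp only [mem_union, mem_image]
    rintro B (hB | ⟨B, hB, rfl⟩) C (hC | ⟨C, hC, rfl⟩) a ha b hb c hc d hd hab hbc hcd
    · exact p5 B hB C hC a ha b hb c hc d hd hab hbc hcd
    · rw [hatt C hC] at hb hd
      have := p2 B hB ha
      have := p2 B hB hc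
      rcases hb with h | h
      · have := q2 C hC h
        omega
      · omega
    · rw [hatt B hB] at ha hc
      have := p2 C hC hb
      have := p2 C hC hd
      rcases hc with h | h
      · have := q2 B hB h
        omega
      · omega
    · have shift : ∀ D ∈ Q, ∀ x ∈ attach p q D, ∃ y ∈ D, (y = x ∨ (x = p ∧ y = q)) := by
        intro D hD x hx
        rcases (hatt D hD x).1 hx with h | ⟨rfl, h⟩
        · exact ⟨x, h, Or.inl rfl⟩
        · exact ⟨q, hqB0, Or.inr ⟨h, rfl⟩⟩
      have : B = C := by
        obtain ⟨a', ha', ea⟩ := shift B hB a ha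
        obtain ⟨b', hb', eb⟩ := shift C hC b hb
        obtain ⟨c', hc', ec⟩ := shift B hB c hc
        obtain ⟨d', hd', ed⟩ := shift C hC d hd
        have := (q2 B hB ha').2
        have := (q2 C hC hb').2
        have := (q2 B hB hc').2
        have := (q2 C hC hd').2
        by_cases hab' : a' = b'
        · exact q4 B hB C hC a' ha' (hab' ▸ hb')
        by_cases hbc' : b' = c'
        · exact q4 B hB C hC c' hc' (hbc' ▸ hb')
        by_cases hcd' : c' = d'
        · exact q4 B hB C hC c' hc' (hcd' ▸ hd')
        exact q5 B hB C hC a' ha' b' hb' c' hc' d' hd' (by omega) (by omega) (by omega)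
      rw [this]

theorem IsNCPartition.subset_or_avoid {s : Finset ℕ} {P : Finset (Finset ℕ)} {p q : ℕ}
    (hpq : p < q) (hP : IsNCPartition s P) (h : Adjacent P p q) {C : Finset ℕ} (hC : C ∈ P) :
    C ⊆ {x ∈ s | p < x ∧ x < q} ∨ ∀ x ∈ C, ¬(p < x ∧ x < q) := by
  obtain ⟨B, hB, hpB, hqB, hBpq⟩ := h
  by_contra! hcon
  obtain ⟨h1, x, hx, hxpq⟩ := hcon
  obtain ⟨y, hy, hy'⟩ := not_subset.1 h1
  simp only [mem_filter, hP.subset C hC hy, true_and] at hy'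
  have hCB : C ≠ B := by
    rintro rfl
    exact hBpq x hx hxpq
  have hyp : y ≠ p := by
    rintro rfl
    exact hCB (hP.disj C hC B hB y hy hpB)
  have hyq : y ≠ q := by
    rintro rfl
    exact hCB (hP.disj C hC B hB y hy hqB)
  rcases lt_or_ge y p with hlt | hge
  · exact hCB (hP.noncrossing C hC B hB y hy p hpB x hx q hqB hlt hxpq.1 hxpq.2)
  · exact hCB (hP.noncrossing B hB C hC p hpB x hx q hqB y hy hxpq.1 hxpq.2 (by omega)).symm

theorem inner_isNCPartition {s : Finset ℕ} {P : Finset (Finset ℕ)} {p q : ℕ}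
    (hpq : p < q) (hP : IsNCPartition s P) (h : Adjacent P p q) :
    IsNCPartition {x ∈ s | p < x ∧ x < q} {C ∈ P | C ⊆ {x ∈ s | p < x ∧ x < q}} := by
  constructor
  · exact fun B hB => hP.nonempty B (mem_filter.1 hB).1
  · exact fun B hB => (mem_filter.1 hB).2
  · intro x hx
    obtain ⟨B, hB, hxB⟩ := hP.cover x (mem_filter.1 hx).1
    refine ⟨B, mem_filter.2 ⟨hB, ?_⟩, hxB⟩
    exact (hP.subset_or_avoid hpq h hB).resolve_right fun h => h x hxB (mem_filter.1 hx).2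
  · exact fun B hB C hC => hP.disj B (mem_filter.1 hB).1 C (mem_filter.1 hC).1
  · exact fun B hB C hC => hP.noncrossing B (mem_filter.1 hB).1 C (mem_filter.1 hC).1

theorem outer_isNCPartition {s : Finset ℕ} {P : Finset (Finset ℕ)} {p q : ℕ}
    (hpq : p < q) (hP : IsNCPartition s P) (h : Adjacent P p q) :
    IsNCPartition {x ∈ s | ¬(p ≤ x ∧ x < q)}
      ({C ∈ P | ¬C ⊆ {x ∈ s | p < x ∧ x < q}}.image (fun C => C.erase p)) := by
  have avoid : ∀ C ∈ P, ¬C ⊆ {x ∈ s | p < x ∧ x < q} → ∀ x ∈ C, ¬(p < x ∧ x < q) :=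
    fun C hC hn => (hP.subset_or_avoid hpq h hC).resolve_left hn
  obtain ⟨B0, hB0, hpB0, hqB0, hBpq⟩ := h
  constructor
  · simp only [mem_image, mem_filter]
    rintro _ ⟨B, ⟨hB, hn⟩, rfl⟩
    by_cases hpB : p ∈ B
    · rw [hP.disj B hB B0 hB0 p hpB hpB0]
      exact ⟨q, mem_erase.2 ⟨by omega, hqB0⟩⟩
    · rw [erase_eq_of_notMem hpB]
      exact hP.nonempty B hB
  · simp only [mem_image, mem_filter]
    rintro _ ⟨B, ⟨hB, hn⟩, rfl⟩ x hx
    obtain ⟨hxp, hx⟩ := mem_erase.1 hx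
    have := avoid B hB hn x hx
    exact mem_filter.2 ⟨hP.subset B hB hx, by omega⟩
  · intro x hx
    obtain ⟨hx, hx'⟩ := mem_filter.1 hx
    obtain ⟨B, hB, hxB⟩ := hP.cover x hx
    refine ⟨B.erase p, mem_image_of_mem _ (mem_filter.2 ⟨hB, fun hs => ?_⟩),
      mem_erase.2 ⟨by omega, hxB⟩⟩
    have := (mem_filter.1 (hs hxB)).2
    omega
  · simp only [mem_image, mem_filter]
    rintro _ ⟨B, ⟨hB, _⟩, rfl⟩ _ ⟨C, ⟨hC, _⟩, rfl⟩ x hxB hxC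
    rw [hP.disj B hB C hC x (mem_of_mem_erase hxB) (mem_of_mem_erase hxC)]
  · simp only [mem_image, mem_filter]
    rintro _ ⟨B, ⟨hB, _⟩, rfl⟩ _ ⟨C, ⟨hC, _⟩, rfl⟩ a ha b hb c hc d hd hab hbc hcd
    rw [hP.noncrossing B hB C hC a (mem_of_mem_erase ha) b (mem_of_mem_erase hb)
      c (mem_of_mem_erase hc) d (mem_of_mem_erase hd) hab hbc hcd]

theorem sum_adjacent (k : Finset ℕ → ℂ) {s : Finset ℕ} {p q : ℕ} {a : ℂ} (hp : p ∈ s)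
    (hq : q ∈ s) (hpq : p < q)
    (hk : ∀ B ⊆ s, q ∈ B → (∀ x ∈ B, ¬(p ≤ x ∧ x < q)) → k (insert p B) = a * k B) :
    ∑ P ∈ ncPartitions s with Adjacent P p q, ∏ B ∈ P, k B =
      a * (ncSum k {x ∈ s | p < x ∧ x < q} * ncSum k {x ∈ s | ¬(p ≤ x ∧ x < q)}) := by
  rw [ncSum, ncSum, sum_mul_sum, ← sum_product', mul_sum]
  symm
  set I : Finset ℕ := {x ∈ s | p < x ∧ x < q} with hI
  set J : Finset ℕ := {x ∈ s | ¬(p ≤ x ∧ x < q)} with hJ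
  have hqJ : q ∈ J := mem_filter.2 ⟨hq, by omega⟩
  have avoidJ : ∀ P ∈ ncPartitions J, ∀ B ∈ P, ∀ x ∈ B, ¬(p ≤ x ∧ x < q) := fun P hP B hB x hx =>
    (mem_filter.1 ((mem_ncPartitions.1 hP).subset B hB hx)).2
  have attach_not : ∀ P ∈ ncPartitions J, ∀ B ∈ P, ¬attach p q B ⊆ I := by
    intro P hP B hB hs
    obtain ⟨x, hx⟩ := (mem_ncPartitions.1 hP).nonempty B hB
    have h1 := avoidJ P hP B hB x hx
    have h2 : x ∈ attach p q B := by
      unfold attach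
      split_ifs
      exacts [mem_insert_of_mem hx, hx]
    have := (mem_filter.1 (hs h2)).2
    omega
  have erase_attach : ∀ P ∈ ncPartitions J, ∀ B ∈ P, (attach p q B).erase p = B := by
    intro P hP B hB
    have hpB : p ∉ B := fun h => avoidJ P hP B hB p h ⟨le_rfl, hpq⟩
    unfold attach
    split_ifs
    exacts [erase_insert hpB, erase_eq_of_notMem hpB]
  have attach_inj : ∀ P ∈ ncPartitions J, Set.InjOn (attach p q) P := by
    intro P hP B hB C hC h
    rw [← erase_attach P hP B hB, ← erase_attach P hP C hC, h]
  refine sum_nbij' (fun PQ => PQ.1 ∪ PQ.2.image (attach p q))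
    (fun P => ({C ∈ P | C ⊆ I}, {C ∈ P | ¬C ⊆ I}.image (fun C => C.erase p))) ?_ ?_ ?_ ?_ ?_
  · rintro ⟨P, Q⟩ hPQ
    obtain ⟨hP, hQ⟩ := mem_product.1 hPQ
    simp only [mem_ncPartitions] at hP hQ
    refine mem_filter.2 ⟨mem_ncPartitions.2 (glue_isNCPartition hp hq hpq hP hQ), ?_⟩
    obtain ⟨B, hB, hqB⟩ := hQ.cover q hqJ
    refine ⟨attach p q B, mem_union_right _ (mem_image_of_mem _ hB), ?_⟩
    rw [attach, if_pos hqB]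
    refine ⟨mem_insert_self _ _, mem_insert_of_mem hqB, fun x hx => ?_⟩
    rcases mem_insert.1 hx with rfl | hx
    · omega
    · have := (mem_filter.1 (hQ.subset B hB hx)).2
      omega
  · intro P hP
    obtain ⟨hP, hadj⟩ := mem_filter.1 hP
    rw [mem_ncPartitions] at hP
    exact mem_product.2 ⟨mem_ncPartitions.2 (inner_isNCPartition hpq hP hadj),
      mem_ncPartitions.2 (outer_isNCPartition hpq hP hadj)⟩
  · rintro ⟨P, Q⟩ hPQ
    obtain ⟨hP, hQ⟩ := mem_product.1 hPQ
    refine Prod.ext ?_ ?_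
    · ext C
      simp only [mem_filter, mem_union, mem_image]
      constructor
      · rintro ⟨hC | ⟨B, hB, rfl⟩, hs⟩
        · exact hC
        · exact absurd hs (attach_not Q hQ B hB)
      · exact fun hC => ⟨Or.inl hC, (mem_ncPartitions.1 hP).subset C hC⟩
    · ext C
      simp only [mem_filter, mem_union, mem_image]
      constructor
      · rintro ⟨D, ⟨hC | ⟨B, hB, rfl⟩, hs⟩, rfl⟩
        · exact absurd ((mem_ncPartitions.1 hP).subset D hC) hs
        · rwa [erase_attach Q hQ B hB]
      · exact fun hC => ⟨attach p q C, ⟨Or.inr ⟨C, hC, rfl⟩, attach_not Q hQ C hC⟩,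
          erase_attach Q hQ C hC⟩
  · intro P hP
    obtain ⟨hP, hadj⟩ := mem_filter.1 hP
    rw [mem_ncPartitions] at hP
    obtain ⟨B0, hB0, hpB0, hqB0, hBpq⟩ := hadj
    have attach_erase : ∀ C ∈ P, attach p q (C.erase p) = C := by
      intro C hC
      unfold attach
      split_ifs with h
      · rw [hP.disj C hC B0 hB0 q (mem_of_mem_erase h) hqB0, insert_erase hpB0]
      · refine erase_eq_of_notMem fun hpC => h ?_
        rw [hP.disj C hC B0 hB0 p hpC hpB0]
        exact mem_erase.2 ⟨by omega, hqB0⟩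
    ext C
    simp only [mem_filter, mem_union, mem_image]
    constructor
    · rintro (hC | ⟨_, ⟨D, ⟨hD, _⟩, rfl⟩, rfl⟩)
      · exact hC.1
      · rwa [attach_erase D hD]
    · intro hC
      by_cases hs : C ⊆ I
      · exact Or.inl ⟨hC, hs⟩
      · exact Or.inr ⟨_, ⟨C, ⟨hC, hs⟩, rfl⟩, attach_erase C hC⟩
  · rintro ⟨P, Q⟩ hPQ
    obtain ⟨hP, hQ⟩ := mem_product.1 hPQ
    have hdis : Disjoint P (Q.image (attach p q)) := by
      rw [disjoint_left]
      intro C hC hC'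
      obtain ⟨B, hB, rfl⟩ := mem_image.1 hC'
      exact attach_not Q hQ B hB ((mem_ncPartitions.1 hP).subset _ hC)
    rw [prod_union hdis, prod_image (attach_inj Q hQ)]
    have hQ' := mem_ncPartitions.1 hQ
    obtain ⟨B, hB, hqB⟩ := hQ'.cover q hqJ
    have h1 : k (attach p q B) = a * k B := by
      rw [attach, if_pos hqB]
      exact hk B ((hQ'.subset B hB).trans (filter_subset _ _)) hqB (avoidJ Q hQ B hB)
    have h2 : ∏ C ∈ Q.erase B, k (attach p q C) = ∏ C ∈ Q.erase B, k C := by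
      refine prod_congr rfl fun C hC => ?_
      obtain ⟨hne, hC⟩ := mem_erase.1 hC
      rw [attach, if_neg fun hqC => hne (hQ'.disj C hC B hB q hqC hqB)]
    rw [← mul_prod_erase Q _ hB, ← mul_prod_erase Q _ hB, h1, h2]
    ring

/-- Schwinger–Dyson recursion for non-crossing sums whose block weights are geometric
at the point `p`. -/
theorem ncSum_eq_recursion (k : Finset ℕ → ℂ) {s T : Finset ℕ} {p : ℕ} {a : ℂ} (hp : p ∈ s)
    (hmul : ∀ q ∈ s, q ∈ T → p < q → ∀ B ⊆ s, q ∈ B → (∀ x ∈ B, ¬(p ≤ x ∧ x < q)) →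
      k (insert p B) = a * k B)
    (hnext : ∀ B ⊆ s, p ∈ B → B ≠ {p} → k B ≠ 0 →
      ∃ q ∈ B, q ∈ T ∧ p < q ∧ ∀ x ∈ B, ¬(p < x ∧ x < q)) :
    ncSum k s = k {p} * ncSum k (s.erase p) +
      a * ∑ q ∈ s with q ∈ T ∧ p < q,
        ncSum k {x ∈ s | p < x ∧ x < q} * ncSum k {x ∈ s | ¬(p ≤ x ∧ x < q)} := by
  have hsplit : ∀ P ∈ ncPartitions s, ∏ B ∈ P, k B =
      (if {p} ∈ P then ∏ B ∈ P, k B else 0) +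
        ∑ q ∈ s with q ∈ T ∧ p < q, if Adjacent P p q then ∏ B ∈ P, k B else 0 := by
    intro P hP
    rw [mem_ncPartitions] at hP
    by_cases hzero : ∏ B ∈ P, k B = 0
    · simp [hzero]
    obtain ⟨B, hB, hpB⟩ := hP.cover p hp
    have huniq : ∀ C ∈ P, p ∈ C → C = B := fun C hC hpC => hP.disj C hC B hB p hpC hpB
    by_cases hBp : B = {p}
    · subst hBp
      rw [if_pos hB, sum_eq_zero, add_zero]
      intro q hq
      refine if_neg ?_
      rintro ⟨C, hC, hpC, hqC, -⟩
      rw [huniq C hC hpC, mem_singleton] at hqC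
      have := (mem_filter.1 hq).2.2
      omega
    · have hkB : k B ≠ 0 := fun h => hzero (prod_eq_zero hB h)
      obtain ⟨q, hqB, hqT, hpq, hav⟩ := hnext B (hP.subset B hB) hpB hBp hkB
      rw [if_neg fun h => hBp (huniq _ h (mem_singleton_self p)).symm, zero_add,
        sum_eq_single q, if_pos ⟨B, hB, hpB, hqB, hav⟩]
      · intro r hr hrq
        refine if_neg ?_
        rintro ⟨C, hC, hpC, hrC, hav'⟩
        obtain rfl := huniq C hC hpC
        have h1 := hav r hrC
        have h2 := hav' q hqB
        have := (mem_filter.1 hr).2.2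
        omega
      · exact fun h => absurd (mem_filter.2 ⟨hP.subset B hB hqB, hqT, hpq⟩) h
  rw [ncSum, sum_congr rfl hsplit, sum_add_distrib, ← sum_filter, sum_singleton_mem k hp, sum_comm,
    mul_sum]
  congr 1
  refine sum_congr rfl fun q hq => ?_
  obtain ⟨hq, hqT, hpq⟩ := mem_filter.1 hq
  rw [← sum_filter, sum_adjacent k hp hq hpq (hmul q hq hqT hpq)]

/-- The product of the letters of `f` at the positions in `s`, in increasing order. -/
def word {A : Type*} [Monoid A] (f : ℕ → A) (s : Finset ℕ) : A :=
  ((s.sort (· ≤ ·)).map f).prod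

/-- The value of a family of multilinear functionals on a list of entries. -/
def listCum {A : Type*} (R : ∀ n, (Fin n → A) → ℂ) (L : List A) : ℂ := R L.length L.get

/-- The cumulant of the letters of `f` at the positions in `B`. -/
def setCum {A : Type*} (R : ∀ n, (Fin n → A) → ℂ) (f : ℕ → A) (B : Finset ℕ) : ℂ :=
  listCum R ((B.sort (· ≤ ·)).map f)

section

variable {A : Type*} (R : ∀ n, (Fin n → A) → ℂ)

theorem eq_listCum {n : ℕ} (g : Fin n → A) {L : List A} (hL : List.ofFn g = L) :
    R n g = listCum R L := by
  have key : ∀ (m : ℕ) (h : n = m) (g' : Fin m → A), (∀ i, g i = g' (Fin.cast h i)) →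
      R n g = R m g' := by
    rintro m rfl g' h
    exact congrArg (R n) (funext h)
  subst hL
  exact key _ (List.length_ofFn).symm _ fun i => by simp

theorem setCum_congr {f f' : ℕ → A} {s : Finset ℕ} (h : ∀ i ∈ s, f i = f' i) :
    setCum R f s = setCum R f' s := by
  rw [setCum, setCum, List.map_congr_left fun i hi => h i ((mem_sort _).1 hi)]

theorem setCum_range {n : ℕ} (f : ℕ → A) : setCum R f (range n) = R n fun i => f i := by
  refine (eq_listCum R _ ?_).symm
  rw [sort_range, ← List.map_coe_finRange_eq_range, List.map_map, List.ofFn_eq_map]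
  rfl

theorem blockCum_eq_setCum {n : ℕ} (f : ℕ → A) (e : Fin n ↪o ℕ) (B : Finset (Fin n)) :
    blockCum R (fun i => f (e i)) B = setCum R f (B.map e.toEmbedding) := by
  refine eq_listCum R _ ?_
  rw [← map_sort (s := B) e.toEmbedding (fun x y => x ≤ y) (fun x y => x ≤ y)
    fun x _ y _ => e.le_iff_le.symm, List.map_map]
  refine List.ext_get (by simp) fun i h1 h2 => ?_
  simp

theorem map_orderEmb_isNCPartition {n : ℕ} (e : Fin n ↪o ℕ) (P : Finset (Finset (Fin n))) :
    IsNCPartition (univ.map e.toEmbedding) (P.image fun B => B.map e.toEmbedding) ↔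
      P ∈ NC n := by
  simp only [NC, mem_filter, mem_univ, true_and]
  constructor
  · rintro ⟨h1, -, h3, h4, h5⟩
    simp only [forall_mem_image] at h1 h4 h5
    refine ⟨⟨fun B hB => by simpa using h1 hB, fun i => ?_⟩, ?_⟩
    · obtain ⟨C, hC, hiC⟩ := h3 (e i) (mem_map_of_mem _ (mem_univ i))
      obtain ⟨B, hB, rfl⟩ := mem_image.1 hC
      refine ⟨B, ⟨hB, by simpa using hiC⟩, fun B' hB' => ?_⟩
      exact map_injective _ (h4 hB'.1 hB (e i) (mem_map_of_mem _ hB'.2) hiC)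
    · intro B hB C hC i hi j hj i' hi' j' hj' h h' hjj
      exact map_injective _ (h5 hB hC (e i) (mem_map_of_mem _ hi) (e j) (mem_map_of_mem _ hj)
        (e i') (mem_map_of_mem _ hi') (e j') (mem_map_of_mem _ hj')
        (e.lt_iff_lt.2 h) (e.lt_iff_lt.2 h') (e.lt_iff_lt.2 hjj))
  · rintro ⟨⟨h1, h2⟩, h3⟩
    constructor
    · simpa only [forall_mem_image, map_nonempty] using fun B hB => h1 B hB
    · simp only [forall_mem_image]
      exact fun B _ => map_subset_map.2 (subset_univ _)
    · intro x hx
      obtain ⟨i, -, rfl⟩ := mem_map.1 hx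
      obtain ⟨B, ⟨hB, hi⟩, -⟩ := h2 i
      exact ⟨_, mem_image_of_mem _ hB, mem_map_of_mem _ hi⟩
    · simp only [forall_mem_image]
      intro B hB C hC x hx hx'
      obtain ⟨i, hi, rfl⟩ := mem_map.1 hx
      rw [(h2 i).unique ⟨hB, hi⟩ ⟨hC, by simpa using hx'⟩]
    · simp only [forall_mem_image]
      intro B hB C hC a ha b hb c hc d hd h h' hcd
      obtain ⟨a, ha', rfl⟩ := mem_map.1 ha
      obtain ⟨b, hb', rfl⟩ := mem_map.1 hb
      obtain ⟨c, hc', rfl⟩ := mem_map.1 hc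
      obtain ⟨d, hd', rfl⟩ := mem_map.1 hd
      rw [h3 B hB C hC a ha' b hb' c hc' d hd' (e.lt_iff_lt.1 h) (e.lt_iff_lt.1 h')
        (e.lt_iff_lt.1 hcd)]

/-- The moment–cumulant formula for words indexed by finite sets of positions. -/
theorem MomentCumulant.word [Monoid A] {φ : A → ℂ} (h : MomentCumulant φ R)
    (f : ℕ → A) (s : Finset ℕ) : φ (word f s) = ncSum (setCum R f) s := by
  set e := s.orderEmbOfFin rfl
  have hs : univ.map e.toEmbedding = s := map_orderEmbOfFin_univ s rfl
  have hw : FreeProbLukacs.word f s = tprod fun i => f (e i) := by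
    rw [FreeProbLukacs.word, ← listMap_orderEmbOfFin_finRange s rfl, tprod, List.map_map,
      List.ofFn_eq_map]
    rfl
  rw [hw, h, ncSum]
  have hinj : Function.Injective fun B : Finset (Fin s.card) => B.map e.toEmbedding :=
    map_injective _
  refine sum_bij (fun P _ => P.image fun B => B.map e.toEmbedding) ?_ ?_ ?_ ?_
  · intro P hP
    rw [mem_ncPartitions]
    simpa only [hs] using (map_orderEmb_isNCPartition e P).2 hP
  · exact fun P _ Q _ hPQ => image_injective hinj hPQ
  · intro Q hQ
    rw [mem_ncPartitions] at hQ
    have : ∀ B ∈ Q, ∃ C : Finset (Fin s.card), C.map e.toEmbedding = B := by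
      intro B hB
      have h := hQ.subset B hB
      rw [← hs] at h
      obtain ⟨C, -, rfl⟩ := subset_map_iff.1 h
      exact ⟨C, rfl⟩
    have hQ' : (univ.filter fun C : Finset (Fin s.card) => C.map e.toEmbedding ∈ Q).image
        (fun B => B.map e.toEmbedding) = Q := by
      ext B
      simp only [mem_image, mem_filter, mem_univ, true_and]
      constructor
      · rintro ⟨C, hC, rfl⟩
        exact hC
      · intro hB
        obtain ⟨C, rfl⟩ := this B hB
        exact ⟨C, hB, rfl⟩
    refine ⟨_, ?_, hQ'⟩
    rw [← map_orderEmb_isNCPartition e, hQ', hs]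
    exact hQ
  · intro P _
    rw [partCum, prod_image fun B _ C _ h => hinj h]
    exact prod_congr rfl fun B _ => blockCum_eq_setCum R f e B

end

section

variable {A : Type*} [Monoid A] (f : ℕ → A)

@[simp]
theorem word_empty : word f ∅ = 1 := by simp [word]

theorem word_congr {f f' : ℕ → A} {s : Finset ℕ} (h : ∀ i ∈ s, f i = f' i) :
    word f s = word f' s := by
  rw [word, word, List.map_congr_left fun i hi => h i ((mem_sort _).1 hi)]

theorem word_insert {p : ℕ} {s : Finset ℕ} (h : ∀ q ∈ s, p < q) :
    word f (insert p s) = f p * word f s := by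
  rw [word, sort_insert _ (fun b hb => (h b hb).le) fun hp => (h p hp).false, List.map_cons,
    List.prod_cons, word]

theorem word_union {s t : Finset ℕ} (h : ∀ p ∈ s, ∀ q ∈ t, p < q) :
    word f (s ∪ t) = word f s * word f t := by
  induction s using Finset.induction_on_min with
  | empty => simp
  | insert p s hp ih =>
    rw [insert_union, word_insert, word_insert f hp,
      ih fun p hp => h p (mem_insert_of_mem hp), mul_assoc]
    intro q hq
    rcases mem_union.1 hq with hq | hq
    exacts [hp q hq, h p (mem_insert_self _ _) q hq]

theorem word_const (x : A) (s : Finset ℕ) : word (fun _ => x) s = x ^ s.card := by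
  simp [word]

end

/-- Moments of an unnormalized semicircle of radius `c` centred at `b`. -/
def semicircleMoment (b c : ℝ) (n : ℕ) : ℝ :=
  ∫ x in (b - c)..(b + c), x ^ n * √(c ^ 2 - (x - b) ^ 2)

theorem semicircleMoment_zero (b : ℝ) {c : ℝ} (hc : 0 ≤ c) :
    semicircleMoment b c 0 = Real.pi * c ^ 2 / 2 := by
  rcases hc.eq_or_lt with rfl | hc
  · simp [semicircleMoment]
  have h1 : semicircleMoment b c 0 = ∫ x in (b - c)..(b + c), c * √(1 - ((x - b) / c) ^ 2) := by
    refine intervalIntegral.integral_congr fun x _ => ?_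
    have : c ^ 2 - (x - b) ^ 2 = c ^ 2 * (1 - ((x - b) / c) ^ 2) := by field_simp
    simp only [pow_zero, one_mul]
    rw [this, Real.sqrt_mul (sq_nonneg c), Real.sqrt_sq hc.le]
  have h2 : ∀ x : ℝ, (x - b) / c = x / c - b / c := fun x => sub_div _ _ _
  rw [h1, intervalIntegral.integral_const_mul]
  simp only [h2]
  rw [intervalIntegral.integral_comp_div_sub (fun x => √(1 - x ^ 2)) hc.ne']
  have h3 : (b - c) / c - b / c = -1 := by field_simp; ring
  have h4 : (b + c) / c - b / c = 1 := by field_simp; ring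
  rw [h3, h4, integral_sqrt_one_sub_sq, smul_eq_mul]
  ring

theorem semicircleMoment_succ (b : ℝ) {c : ℝ} (hc : 0 ≤ c) (n : ℕ) :
    (n + 3) * semicircleMoment b c (n + 1) =
      (2 * n + 3) * b * semicircleMoment b c n -
        n * (b ^ 2 - c ^ 2) * semicircleMoment b c (n - 1) := by
  have hint : ∀ m : ℕ, IntervalIntegrable (fun x => x ^ m * √(c ^ 2 - (x - b) ^ 2))
      MeasureTheory.volume (b - c) (b + c) := fun m =>
    Continuous.intervalIntegrable (by fun_prop) _ _
  have key := intervalIntegral.integral_eq_sub_of_hasDerivAt_of_le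
    (f := fun x => x ^ n * ((c ^ 2 - (x - b) ^ 2) * √(c ^ 2 - (x - b) ^ 2)))
    (f' := fun x => ((2 * n + 3) * b * (x ^ n * √(c ^ 2 - (x - b) ^ 2)) -
      n * (b ^ 2 - c ^ 2) * (x ^ (n - 1) * √(c ^ 2 - (x - b) ^ 2))) -
      (n + 3) * (x ^ (n + 1) * √(c ^ 2 - (x - b) ^ 2)))
    (a := b - c) (b := b + c) (by linarith) (by fun_prop) ?_ ?_
  · rw [intervalIntegral.integral_sub, intervalIntegral.integral_sub,
      intervalIntegral.integral_const_mul, intervalIntegral.integral_const_mul,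
      intervalIntegral.integral_const_mul] at key
    · have h1 : c ^ 2 - (b + c - b) ^ 2 = 0 := by ring
      have h2 : c ^ 2 - (b - c - b) ^ 2 = 0 := by ring
      simp only [h1, h2, zero_mul, mul_zero, sub_zero] at key
      simp only [semicircleMoment]
      linarith
    · exact (hint n).const_mul _
    · exact (hint _).const_mul _
    · exact ((hint n).const_mul _).sub ((hint _).const_mul _)
    · exact (hint _).const_mul _
  · intro x hx
    have hpos : 0 < c ^ 2 - (x - b) ^ 2 := by nlinarith [hx.1, hx.2]
    have hd : HasDerivAt (fun x => c ^ 2 - (x - b) ^ 2) (-2 * (x - b)) x := by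
      have := (((hasDerivAt_id x).sub_const b).pow 2).const_sub (c ^ 2)
      exact this.congr_deriv (by simp)
    have hs := hd.sqrt hpos.ne'
    have := (hasDerivAt_pow n x).mul (hd.mul hs)
    refine this.congr_deriv ?_
    have hsq : √(c ^ 2 - (x - b) ^ 2) ≠ 0 := (Real.sqrt_pos.2 hpos).ne'
    have hss := Real.sq_sqrt hpos.le
    have hds : (c ^ 2 - (x - b) ^ 2) * (-2 * (x - b) / (2 * √(c ^ 2 - (x - b) ^ 2))) =
        - (x - b) * √(c ^ 2 - (x - b) ^ 2) := by
      field_simp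
      rw [hss]
    rw [Pi.mul_apply, hds]
    rcases n with _ | n
    · simp
      ring
    · push_cast
      ring
  · exact Continuous.intervalIntegrable (by fun_prop) _ _

open PowerSeries in
/-- The only square root of `1 - 2bX + dX²` with constant coefficient `1` is determined by a
linear first order differential equation. -/
theorem sq_eq_of_derivative {S D : PowerSeries ℝ} (hS : constantCoeff S = 1)
    (hD : constantCoeff D = 1)
    (h : 2 * D * derivative ℝ S = derivative ℝ D * S) : S ^ 2 = D := by
  have hD0 : constantCoeff D ≠ 0 := by rw [hD]; exact one_ne_zero
  have hDne : D ≠ 0 := fun h => hD0 (by simp [h])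
  set Q := S ^ 2 * D⁻¹ with hQ
  have hQD : Q * D = S ^ 2 := by rw [hQ, mul_assoc, PowerSeries.inv_mul_cancel _ hD0, mul_one]
  have h1 : derivative ℝ (Q * D) = derivative ℝ (S ^ 2) := by rw [hQD]
  rw [Derivation.leibniz, Derivation.leibniz_pow] at h1
  simp only [smul_eq_mul, nsmul_eq_mul, Nat.cast_ofNat] at h1
  have h2 : derivative ℝ Q = 0 := by
    have : derivative ℝ Q * D ^ 2 = 0 := by
      linear_combination D * h1 + S * h - derivative ℝ D * hQD
    exact (mul_eq_zero.1 this).resolve_right (pow_ne_zero 2 hDne)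
  have h3 : Q = 1 := by
    refine PowerSeries.derivative.ext (R := ℝ) ?_ ?_
    · rw [h2]; simp
    · have := congrArg constantCoeff hQD
      simpa [hS, hD] using this
  rw [← hQD, h3, one_mul]

open PowerSeries in
theorem convolution_of_linear_recursion {J : ℕ → ℝ} {l a b d : ℝ} (ha : a ≠ 0)
    (hb : b = a * (1 + l)) (hd : d = b ^ 2 - 4 * l * a ^ 2) (h0 : J 0 = l * a)
    (hJ : ∀ n : ℕ, (n + 3) * J (n + 1) = (2 * n + 3) * b * J n - n * d * J (n - 1)) :
    PowerSeries.mk J = C (l * a) * (1 + X * PowerSeries.mk J) +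
      C a * ((1 + X * PowerSeries.mk J) * (X * PowerSeries.mk J)) := by
  set g := PowerSeries.mk J
  have hC : C d = C b ^ 2 - 4 * C l * C a ^ 2 := by
    rw [hd]; simp [map_ofNat]
  have hCb : C b = C a * (1 + C l) := by rw [hb]; simp
  have hE : ∀ n, coeff n (X * derivative ℝ g) = n * J n := by
    rintro (_ | n)
    · simp
    · rw [coeff_succ_X_mul, coeff_derivative, coeff_mk]
      push_cast
      ring
  have hg : X * derivative ℝ g + C 2 * (g - C (l * a)) -
      C b * (X * (C 2 * (X * derivative ℝ g) + C 3 * g)) +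
      C d * (X * (X * (X * derivative ℝ g + g))) = 0 := by
    ext n
    rcases n with _ | n
    · simp [g, h0]
    · simp only [map_add, map_sub, map_zero, coeff_C_mul, coeff_succ_X_mul, hE]
      have := hJ n
      rcases n with _ | n
      · simp [g] at this ⊢
        linarith
      · simp only [coeff_succ_X_mul, map_add, hE, g, coeff_mk, coeff_C, Nat.succ_ne_zero, if_false]
        push_cast [Nat.add_sub_cancel] at this ⊢
        linear_combination this
  have hode : 2 * (1 - C (2 * b) * X + C d * X ^ 2) *
      derivative ℝ (1 - C b * X - C (2 * a) * (X ^ 2 * g)) =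
      derivative ℝ (1 - C (2 * b) * X + C d * X ^ 2) * (1 - C b * X - C (2 * a) * (X ^ 2 * g)) := by
    simp only [map_add, map_sub, Derivation.leibniz, Derivation.leibniz_pow, derivative_C,
      derivative_X, Derivation.map_one_eq_zero, smul_eq_mul, nsmul_eq_mul]
    simp only [map_mul, map_ofNat] at hg ⊢
    push_cast
    linear_combination (-4 * C a * X) * hg - 2 * X * hC
  have hsq := sq_eq_of_derivative (by simp) (by simp) hode
  have hne : (4 * C a * X ^ 2 : PowerSeries ℝ) ≠ 0 := by
    refine mul_ne_zero (mul_ne_zero (fun h => by simpa [map_ofNat] using congrArg constantCoeff h) ?_)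
      (pow_ne_zero _ X_ne_zero)
    simpa using ha
  refine mul_left_cancel₀ hne ?_
  simp only [map_mul, map_ofNat] at hsq ⊢
  linear_combination (-1 : PowerSeries ℝ) * hsq - X ^ 2 * hC +
    4 * C a * X ^ 3 * g * hCb

theorem freePoissonMeasure_moment {l a : ℝ} (hl : 0 ≤ l) (ha : 0 < a) (n : ℕ) :
    ∫ t, t ^ (n + 1) ∂freePoissonMeasure l a =
      semicircleMoment (a * (1 + l)) (2 * a * √l) n / (2 * Real.pi * a) := by
  set b := a * (1 + l) with hb
  set c := 2 * a * √l with hc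
  have hc0 : 0 ≤ c := by positivity
  have hc2 : c ^ 2 = 4 * l * a ^ 2 := by
    rw [hc, mul_pow, Real.sq_sqrt hl]; ring
  have hbc : c ^ 2 ≤ b ^ 2 := by
    rw [hc2, hb]; nlinarith [mul_nonneg (sq_nonneg a) (sq_nonneg (1 - l))]
  have hdens : ∀ x, freePoissonDensity l a x = √(c ^ 2 - (x - b) ^ 2) / (2 * Real.pi * a * x) := by
    intro x
    rw [freePoissonDensity, hc2]
  have hb0 : 0 < b := by positivity
  have hneg : ∀ x ≤ 0, √(c ^ 2 - (x - b) ^ 2) = 0 := fun x hx =>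
    Real.sqrt_eq_zero_of_nonpos (by nlinarith)
  have hnonneg : ∀ x, 0 ≤ freePoissonDensity l a x := by
    intro x
    rw [hdens]
    rcases le_total x 0 with hx | hx
    · rw [hneg x hx, zero_div]
    · positivity
  have hmul : ∀ x, freePoissonDensity l a x * x ^ (n + 1) =
      x ^ n * √(c ^ 2 - (x - b) ^ 2) / (2 * Real.pi * a) := by
    intro x
    rw [hdens]
    rcases eq_or_ne x 0 with rfl | hx
    · rw [hneg 0 le_rfl]; simp
    · have := Real.pi_ne_zero
      field_simp
      ring
  have hsupp : ∀ x ∉ Set.Ioc (b - c) (b + c),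
      x ^ n * √(c ^ 2 - (x - b) ^ 2) / (2 * Real.pi * a) = 0 := by
    intro x hx
    rw [Real.sqrt_eq_zero_of_nonpos, mul_zero, zero_div]
    rw [Set.mem_Ioc, not_and_or, not_lt, not_le] at hx
    rcases hx with hx | hx <;> nlinarith
  have hcont : Continuous fun x : ℝ => x ^ n * √(c ^ 2 - (x - b) ^ 2) / (2 * Real.pi * a) := by
    fun_prop
  have hint : MeasureTheory.Integrable
      fun x : ℝ => x ^ n * √(c ^ 2 - (x - b) ^ 2) / (2 * Real.pi * a) := by
    refine hcont.integrable_of_hasCompactSupport ?_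
    refine HasCompactSupport.intro (isCompact_Icc (a := b - c) (b := b + c)) fun x hx => ?_
    exact hsupp x fun h => hx (Set.Ioc_subset_Icc_self h)
  have hmeas : Measurable fun x => ENNReal.ofReal (freePoissonDensity l a x) := by
    unfold freePoissonDensity
    fun_prop
  have hfin : ∀ᵐ x, ENNReal.ofReal (freePoissonDensity l a x) < ⊤ :=
    Filter.Eventually.of_forall fun x => ENNReal.ofReal_lt_top
  have hsmul : ∀ x : ℝ, (ENNReal.ofReal (freePoissonDensity l a x)).toReal • x ^ (n + 1) =
      x ^ n * √(c ^ 2 - (x - b) ^ 2) / (2 * Real.pi * a) := by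
    intro x
    rw [ENNReal.toReal_ofReal (hnonneg x), smul_eq_mul, hmul]
  rw [freePoissonMeasure, MeasureTheory.integral_add_measure,
    MeasureTheory.integral_smul_measure, MeasureTheory.integral_dirac,
    integral_withDensity_eq_integral_toReal_smul hmeas hfin]
  · simp only [hsmul]
    rw [zero_pow n.succ_ne_zero, smul_zero, zero_add,
      ← MeasureTheory.setIntegral_eq_integral_of_forall_compl_eq_zero hsupp,
      ← intervalIntegral.integral_of_le (by linarith), intervalIntegral.integral_div,
      semicircleMoment]
  · exact (MeasureTheory.integrable_dirac (by simp)).smul_measure ENNReal.ofReal_ne_top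
  · rw [MeasureTheory.integrable_withDensity_iff_integrable_smul' hmeas hfin]
    simpa only [hsmul] using hint

/-- The moments of the free Poisson law satisfy a convolution recursion. -/
theorem freePoissonMeasure_moment_succ {l a : ℝ} (hl : 0 ≤ l) (ha : 0 < a) {m : ℕ → ℝ}
    (h0 : m 0 = 1) (hm : ∀ n, m (n + 1) = ∫ t, t ^ (n + 1) ∂freePoissonMeasure l a) (r : ℕ) :
    m (r + 1) = l * a * m r + a * ∑ i ∈ range r, m i * m (r - i) := by
  have hc2 : (2 * a * √l) ^ 2 = 4 * l * a ^ 2 := by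
    rw [mul_pow, Real.sq_sqrt hl]; ring
  have hpi := Real.pi_ne_zero
  have hJ : ∀ n, m (n + 1) =
      semicircleMoment (a * (1 + l)) (2 * a * √l) n / (2 * Real.pi * a) := fun n => by
    rw [hm, freePoissonMeasure_moment hl ha]
  have key := convolution_of_linear_recursion (J := fun n => m (n + 1)) (l := l)
    ha.ne' rfl rfl ?_ ?_
  · have h1 : ∀ n, PowerSeries.coeff n (PowerSeries.X * PowerSeries.mk fun n => m (n + 1)) =
        if n = 0 then 0 else m n := by
      rintro (_ | n) <;> simp [PowerSeries.coeff_succ_X_mul]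
    have h2 : ∀ n, PowerSeries.coeff n
        (1 + PowerSeries.X * PowerSeries.mk fun n => m (n + 1)) = m n := by
      rintro (_ | n) <;> simp [h0, PowerSeries.coeff_succ_X_mul, PowerSeries.coeff_one]
    have := congrArg (PowerSeries.coeff r) key
    rw [map_add, PowerSeries.coeff_C_mul, PowerSeries.coeff_C_mul, PowerSeries.coeff_mul,
      PowerSeries.coeff_mk, Finset.Nat.sum_antidiagonal_eq_sum_range_succ_mk,
      sum_range_succ] at this
    simp only [h1, h2, Nat.sub_self, if_true, mul_zero, add_zero] at this
    rw [this]
    congr 2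
    refine sum_congr rfl fun i hi => ?_
    rw [if_neg (Nat.sub_ne_zero_of_lt (mem_range.1 hi))]
  · simp only [hJ]
    rw [semicircleMoment_zero _ (by positivity), hc2]
    field_simp
    ring
  · intro n
    have := semicircleMoment_succ (a * (1 + l)) (c := 2 * a * √l) (by positivity) n
    rw [hc2] at this
    simp only [hJ]
    rcases n with _ | n
    · simp only [Nat.cast_zero, zero_mul, sub_zero] at this ⊢
      rw [← mul_div_assoc, ← mul_div_assoc, this]
    · simp only [Nat.add_sub_cancel] at this ⊢
      rw [← mul_div_assoc, ← mul_div_assoc, ← mul_div_assoc, this, sub_div]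

@[simp]
theorem ncSum_empty (k : Finset ℕ → ℂ) : ncSum k ∅ = 1 := by
  have : ncPartitions ∅ = {∅} := by
    ext P
    rw [mem_ncPartitions, mem_singleton]
    constructor
    · rintro ⟨h1, h2, -, -, -⟩
      refine eq_empty_of_forall_notMem fun B hB => ?_
      have := h1 B hB
      rw [subset_empty.1 (h2 B hB)] at this
      exact not_nonempty_empty this
    · rintro rfl
      constructor <;> simp
  simp [ncSum, this]

/-- The recursion `ncSum_eq_recursion` at the smallest point. -/
theorem ncSum_insert (k : Finset ℕ → ℂ) {t T : Finset ℕ} {p : ℕ} {a : ℂ} (hp : ∀ q ∈ t, p < q)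
    (hmul : ∀ B ⊆ t, ∀ q ∈ B, q ∈ T → (∀ x ∈ B, q ≤ x) → k (insert p B) = a * k B)
    (hzero : ∀ B ⊆ t, ∀ q ∈ B, q ∉ T → (∀ x ∈ B, q ≤ x) → k (insert p B) = 0) :
    ncSum k (insert p t) = k {p} * ncSum k t +
      a * ∑ q ∈ t with q ∈ T, ncSum k {x ∈ t | x < q} * ncSum k {x ∈ t | q ≤ x} := by
  have hpt : p ∉ t := fun h => (hp p h).false
  rw [ncSum_eq_recursion k (T := T) (mem_insert_self p t) (a := a), erase_insert hpt]
  · have h1 : {q ∈ insert p t | q ∈ T ∧ p < q} = {q ∈ t | q ∈ T} := by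
      ext q
      simp only [mem_filter, mem_insert]
      constructor
      · rintro ⟨rfl | hq, hT, hlt⟩
        exacts [absurd hlt (lt_irrefl _), ⟨hq, hT⟩]
      · exact fun h => ⟨Or.inr h.1, h.2, hp q h.1⟩
    rw [h1]
    congr 2
    refine sum_congr rfl fun q hq => ?_
    have hpq := hp q (mem_filter.1 hq).1
    congr 2
    · ext x
      simp only [mem_filter, mem_insert]
      constructor
      · rintro ⟨rfl | hx, h, h'⟩
        exacts [absurd h (lt_irrefl _), ⟨hx, h'⟩]
      · exact fun h => ⟨Or.inr h.1, hp x h.1, h.2⟩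
    · ext x
      simp only [mem_filter, mem_insert]
      constructor
      · rintro ⟨rfl | hx, h⟩
        exacts [absurd ⟨le_rfl, hpq⟩ h, ⟨hx, not_lt.1 fun h' => h ⟨(hp x hx).le, h'⟩⟩]
      · exact fun h => ⟨Or.inr h.1, fun h' => absurd h'.2 (not_lt.2 h.2)⟩
  · intro q _ hqT hpq B hB hqB hav
    have hpB : p ∉ B := fun h => hav p h ⟨le_rfl, hpq⟩
    have hBt : B ⊆ t := (subset_insert_iff_of_notMem hpB).1 hB
    refine hmul B hBt q hqB hqT fun x hx => not_lt.1 fun h => hav x hx ⟨(hp x (hBt hx)).le, h⟩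
  · intro B hB hpB hne hk
    have hBt : B.erase p ⊆ t := by
      rw [← erase_insert hpt]
      exact erase_subset_erase p hB
    have hne' : (B.erase p).Nonempty := by
      rw [nonempty_iff_ne_empty]
      exact fun h => hne ((erase_eq_empty_iff B p).1 h |>.resolve_left (ne_empty_of_mem hpB))
    have hmem := min'_mem _ hne'
    have hmin : ∀ x ∈ B.erase p, (B.erase p).min' hne' ≤ x := fun x hx => min'_le _ x hx
    refine ⟨_, mem_of_mem_erase hmem, ?_, hp _ (hBt hmem), fun x hx h => ?_⟩
    · by_contra hT
      have := hzero _ hBt _ hmem hT hmin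
      rw [insert_erase hpB] at this
      exact hk this
    · exact absurd h.2 (not_lt.2 (hmin x (mem_erase.2 ⟨h.1.ne', hx⟩)))

theorem sum_rank {M : Type*} [AddCommMonoid M] (F : ℕ → ℕ → M) (t : Finset ℕ) :
    ∑ q ∈ t, F #{x ∈ t | x < q} #{x ∈ t | q ≤ x} = ∑ i ∈ range #t, F i (#t - i) := by
  induction t using Finset.induction_on_min generalizing F with
  | empty => simp
  | insert p t hp ih =>
    have hpt : p ∉ t := fun h => (hp p h).false
    rw [sum_insert hpt, card_insert_of_notMem hpt, sum_range_succ', add_comm]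
    congr 1
    · have := ih fun i j => F (i + 1) j
      simp only [Nat.add_sub_add_right]
      rw [← this]
      refine sum_congr rfl fun q hq => ?_
      rw [filter_insert, filter_insert, if_pos (hp q hq), if_neg (not_le.2 (hp q hq)),
        card_insert_of_notMem fun h => hpt (mem_filter.1 h).1]
    · rw [filter_insert, filter_insert, if_neg (lt_irrefl p), if_pos le_rfl,
        filter_false_of_mem fun x hx => not_lt.2 (hp x hx).le,
        filter_true_of_mem fun x hx => (hp x hx).le, card_insert_of_notMem hpt]
      simp

/-- Non-crossing sums of geometric weights. -/
theorem ncSum_geometric {l a : ℂ} {m : ℕ → ℂ} (h0 : m 0 = 1)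
    (hm : ∀ r, m (r + 1) = l * a * m r + a * ∑ i ∈ range r, m i * m (r - i)) (s : Finset ℕ) :
    ncSum (fun B => l * a ^ #B) s = m #s := by
  induction s using Finset.strongInduction with
  | H s ih =>
    rcases s.eq_empty_or_nonempty with rfl | hs
    · simp [h0]
    · set p := s.min' hs
      set t := s.erase p with ht
      have hps : p ∈ s := min'_mem s hs
      have hst : s = insert p t := (insert_erase hps).symm
      have hp : ∀ q ∈ t, p < q := fun q hq => min'_lt_of_mem_erase_min' s hs hq
      have hpt : p ∉ t := notMem_erase p s
      have hlt : t ⊂ s := erase_ssubset hps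
      rw [hst, ncSum_insert (T := t) (a := a) _ hp, filter_true_of_mem fun _ h => h,
        ih t hlt, card_insert_of_notMem hpt, hm, ← sum_rank fun i j => m i * m j]
      · congr 1
        · simp
        · congr 1
          refine sum_congr rfl fun q _ => ?_
          rw [ih _ ((filter_subset _ _).trans_ssubset hlt),
            ih _ ((filter_subset _ _).trans_ssubset hlt)]
      · intro B hB q _ _ _
        rw [card_insert_of_notMem fun h => hpt (hB h)]
        ring
      · exact fun B hB q hq hqt => absurd (hB hq) hqt

section FreePoisson

variable {A : Type*}

/-- The free cumulants of a free Poisson element are geometric. -/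
theorem setCum_freePoisson [Monoid A] {φ : A → ℂ} {R : ∀ n, (Fin n → A) → ℂ}
    (hmc : MomentCumulant φ R) (h1 : φ 1 = 1) {x : A} {l a : ℝ} (hl : 0 ≤ l) (ha : 0 < a)
    (hx : HasMoments φ x (freePoissonMeasure l a)) {B : Finset ℕ} (hB : B.Nonempty) :
    setCum R (fun _ => x) B = l * a ^ #B := by
  refine eq_of_ncSum_eq (k' := fun B => (l * a ^ #B : ℂ)) hB fun t _ => ?_
  have h0 : ∫ t, t ^ 0 ∂freePoissonMeasure l a = 1 := by
    have := hx 0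
    rw [pow_zero, h1] at this
    exact_mod_cast this.symm
  rw [← hmc.word, word_const, ncSum_geometric (m := fun n => φ (x ^ n))]
  · simpa using h1
  · intro r
    have := freePoissonMeasure_moment_succ hl ha
      (m := fun n => ∫ t, t ^ n ∂freePoissonMeasure l a) h0 (fun n => rfl) r
    simp only [hx _]
    exact_mod_cast this

/-- The sequence with letter `x` at the positions in `T` and `y` elsewhere. -/
def twoLetter (T : Finset ℕ) (x y : A) (i : ℕ) : A := if i ∈ T then x else y

theorem setCum_twoLetter_of_subset (R : ∀ n, (Fin n → A) → ℂ) {T B : Finset ℕ} (x y : A)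
    (h : B ⊆ T) : setCum R (twoLetter T x y) B = setCum R (fun _ => x) B :=
  setCum_congr R fun _ hi => if_pos (h hi)

theorem setCum_twoLetter_of_mixed {R : ∀ n, (Fin n → A) → ℂ} {T B : Finset ℕ} {x y : A}
    (hfree : FreeElems R x y) {i j : ℕ} (hi : i ∈ B) (hiT : i ∈ T) (hj : j ∈ B) (hjT : j ∉ T) :
    setCum R (twoLetter T x y) B = 0 := by
  refine hfree _ _ (fun m => ?_) ?_ ?_
  · have := List.get_mem ((B.sort (· ≤ ·)).map (twoLetter T x y)) m
    obtain ⟨r, -, hr⟩ := List.mem_map.1 this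
    rw [← hr, twoLetter]
    split_ifs <;> simp
  · obtain ⟨m, hm⟩ := List.mem_iff_get.1
      (List.mem_map_of_mem (f := twoLetter T x y) ((mem_sort (· ≤ ·)).2 hi))
    exact ⟨m, by rw [hm, twoLetter, if_pos hiT]; rfl⟩
  · obtain ⟨m, hm⟩ := List.mem_iff_get.1
      (List.mem_map_of_mem (f := twoLetter T x y) ((mem_sort (· ≤ ·)).2 hj))
    exact ⟨m, by rw [hm, twoLetter, if_neg hjT]; rfl⟩

theorem twoLetter_congr {T T' : Finset ℕ} {i : ℕ} (x y : A) (h : i ∈ T ↔ i ∈ T') :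
    twoLetter T x y i = twoLetter T' x y i := by
  simp only [twoLetter, h]

theorem FreeElems.symm {R : ∀ n, (Fin n → A) → ℂ} {x y : A} (h : FreeElems R x y) :
    FreeElems R y x :=
  fun n f hf hy hx => h n f (fun i => (hf i).symm) hx hy

section SchwingerDyson

variable [Monoid A] {φ : A → ℂ} {R : ∀ n, (Fin n → A) → ℂ} {x y : A} {l k a : ℂ}
  {T t : Finset ℕ}

theorem schwingerDyson_left (hmc : MomentCumulant φ R) (hfree : FreeElems R x y)
    (hx : ∀ B : Finset ℕ, B.Nonempty → setCum R (fun _ => x) B = l * a ^ #B)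
    (ht : ∀ q ∈ t, 0 < q) :
    φ (x * word (twoLetter T x y) t) = l * a * φ (word (twoLetter T x y) t) +
      a * ∑ q ∈ t with q ∈ T, φ (word (twoLetter T x y) {i ∈ t | i < q}) *
        φ (word (twoLetter T x y) {i ∈ t | q ≤ i}) := by
  have h0 : 0 ∉ t := fun h => (ht 0 h).false
  have hT : ∀ s ⊆ t, word (twoLetter T x y) s = word (twoLetter (insert 0 T) x y) s :=
    fun s hs => word_congr fun i hi => twoLetter_congr _ _ <| by
      simp [show i ≠ 0 from fun h => h0 (h ▸ hs hi)]
  have hx0 : x = twoLetter (insert 0 T) x y 0 := (if_pos (mem_insert_self 0 T)).symm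
  have hfil : {q ∈ t | q ∈ T} = {q ∈ t | q ∈ insert 0 T} :=
    filter_congr fun q hq => by simp [(ht q hq).ne']
  rw [hT t subset_rfl]
  nth_rewrite 1 [hx0]
  rw [← word_insert _ ht, hmc.word, hmc.word, hfil,
    sum_congr rfl fun q _ => by
      rw [hT _ (filter_subset _ _), hT _ (filter_subset _ _), hmc.word, hmc.word],
    ncSum_insert (T := insert 0 T) (a := a) _ ht,
    setCum_twoLetter_of_subset R x y (by simp), hx _ (singleton_nonempty 0)]
  · simp
  · intro B hB q hq hqT hmin
    by_cases hBT : B ⊆ insert 0 T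
    · rw [setCum_twoLetter_of_subset R x y hBT,
        setCum_twoLetter_of_subset R x y (insert_subset (mem_insert_self _ _) hBT),
        hx B ⟨q, hq⟩, hx _ (insert_nonempty 0 B), card_insert_of_notMem fun h => h0 (hB h)]
      ring
    · obtain ⟨j, hj, hjT⟩ := not_subset.1 hBT
      rw [setCum_twoLetter_of_mixed hfree hq hqT hj hjT,
        setCum_twoLetter_of_mixed hfree (mem_insert_of_mem hq) hqT (mem_insert_of_mem hj) hjT,
        mul_zero]
  · exact fun B hB q hq hqT _ => setCum_twoLetter_of_mixed hfree (mem_insert_self 0 B)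
      (mem_insert_self 0 T) (mem_insert_of_mem hq) hqT

theorem schwingerDyson_right (hmc : MomentCumulant φ R) (hfree : FreeElems R x y)
    (hy : ∀ B : Finset ℕ, B.Nonempty → setCum R (fun _ => y) B = k * a ^ #B)
    (ht : ∀ q ∈ t, 0 < q) :
    φ (y * word (twoLetter T x y) t) = k * a * φ (word (twoLetter T x y) t) +
      a * ∑ q ∈ t with q ∉ T, φ (word (twoLetter T x y) {i ∈ t | i < q}) *
        φ (word (twoLetter T x y) {i ∈ t | q ≤ i}) := by
  have hT : ∀ s ⊆ t, word (twoLetter T x y) s = word (twoLetter (t \ T) y x) s :=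
    fun s hs => word_congr fun i hi => by
      have := hs hi
      by_cases h : i ∈ T <;> simp [twoLetter, h, this]
  have hfil : {q ∈ t | q ∉ T} = {q ∈ t | q ∈ t \ T} :=
    filter_congr fun q hq => by simp [hq]
  rw [hT t subset_rfl, schwingerDyson_left hmc hfree.symm hy ht, hfil]
  congr 2
  exact sum_congr rfl fun q _ => by rw [hT _ (filter_subset _ _), hT _ (filter_subset _ _)]

end SchwingerDyson

/-- The Schwinger–Dyson equation for the sum of two free elements with geometric cumulants. -/
theorem schwingerDyson_add [Ring A] [Module ℂ A] {φ : A →ₗ[ℂ] ℂ} {R : ∀ n, (Fin n → A) → ℂ}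
    {x y : A} {l k a : ℂ} {T t : Finset ℕ} (hmc : MomentCumulant φ R) (hfree : FreeElems R x y)
    (hx : ∀ B : Finset ℕ, B.Nonempty → setCum R (fun _ => x) B = l * a ^ #B)
    (hy : ∀ B : Finset ℕ, B.Nonempty → setCum R (fun _ => y) B = k * a ^ #B)
    (ht : ∀ q ∈ t, 0 < q) :
    φ ((x + y) * word (twoLetter T x y) t) = (l + k) * a * φ (word (twoLetter T x y) t) +
      a * ∑ q ∈ t, φ (word (twoLetter T x y) {i ∈ t | i < q}) *
        φ (word (twoLetter T x y) {i ∈ t | q ≤ i}) := by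
  rw [add_mul, map_add, schwingerDyson_left hmc hfree hx ht,
    schwingerDyson_right hmc hfree hy ht, ← sum_filter_add_sum_filter_not t (· ∈ T)]
  ring

end FreePoisson

section CStar

variable {A : Type*} [NormedRing A] [StarRing A] [CStarRing A] [CompleteSpace A]
  [NormedAlgebra ℂ A] [StarModule ℂ A]

open scoped ComplexOrder in
theorem IsState.continuous {φ : A →ₗ[ℂ] ℂ} (h : IsState φ) : Continuous φ := by
  let _ : CStarAlgebra A := {}
  let _ := CStarAlgebra.spectralOrder A
  have := CStarAlgebra.spectralOrderedRing A
  let ψ : A →ₚ[ℂ] ℂ := PositiveLinearMap.mk₀ φ fun a ha => by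
    obtain ⟨b, rfl⟩ := CStarAlgebra.nonneg_iff_eq_star_mul_self.1 ha
    obtain ⟨r, hr, hr'⟩ := h.2 b
    rw [hr']
    exact_mod_cast hr
  obtain ⟨C, hC⟩ := ψ.exists_norm_apply_le
  exact (φ.mkContinuous C fun a => hC a).continuous

/-- An invertible square of a self-adjoint element has a positive multiple close to `1`. -/
theorem exists_norm_one_sub_smul_lt {u : A} (hu : IsSelfAdjoint u) (h : IsUnit (u * u)) :
    ∃ c : ℝ, 0 < c ∧ ‖1 - (c : ℂ) • (u * u)‖ < 1 := by
  let _ : CStarAlgebra A := {}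
  let _ := CStarAlgebra.spectralOrder A
  have := CStarAlgebra.spectralOrderedRing A
  set v := u * u with hv
  have hv0 : 0 ≤ v := by
    have := star_mul_self_nonneg u
    rwa [hu.star_eq] at this
  have hvsa : IsSelfAdjoint v := .of_nonneg hv0
  set M := ‖v‖ * ‖(1 : A)‖ with hM
  have hM0 : 0 ≤ M := by positivity
  refine ⟨(M + 1)⁻¹, by positivity, ?_⟩
  have hcfc : cfc (fun x : ℝ => 1 - (M + 1)⁻¹ * x) v = 1 - (((M + 1)⁻¹ : ℝ) : ℂ) • v := by
    rw [cfc_sub _ _ v, cfc_const_one ℝ v, cfc_const_mul_id _ v]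
    rfl
  rw [← hcfc]
  refine norm_cfc_lt one_pos fun x hx => ?_
  have h1 : 0 ≤ x := spectrum_nonneg_of_nonneg hv0 hx
  have h2 : x ≠ 0 := by
    rintro rfl
    exact spectrum.zero_notMem ℝ h hx
  have h3 : x ≤ M := (le_abs_self x).trans (spectrum.norm_le_norm_mul_of_mem hx)
  have h4 : 0 < (M + 1)⁻¹ * x := by positivity
  have h5 : (M + 1)⁻¹ * x < 1 := by
    rw [inv_mul_lt_one₀ (by positivity)]
    linarith
  rw [Real.norm_eq_abs, abs_lt]
  constructor <;> linarith

end CStar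

section Prepend

variable {A : Type*} [NormedRing A] [NormedAlgebra ℂ A] (φ : A →L[ℂ] ℂ)

/-- The operator on `A × A` that prepends the letter `c`, recording in the first component
the contraction with this letter with weight `e`. -/
def prependOp (c : A) (e : ℂ) : A × A →L[ℂ] A × A :=
  ((ContinuousLinearMap.mul ℂ A c).comp (.fst ℂ A A) +
    (((e • φ).comp (ContinuousLinearMap.mul ℂ A c)).comp (.snd ℂ A A)).smulRight 1).prod
    ((ContinuousLinearMap.mul ℂ A c).comp (.snd ℂ A A))

@[simp]
theorem prependOp_apply (c : A) (e : ℂ) (x : A × A) :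
    prependOp φ c e x = (c * x.1 + (e * φ (c * x.2)) • 1, c * x.2) := rfl

theorem word_prependOp (f : ℕ → A) (T s : Finset ℕ) (q : A) :
    word (fun i => prependOp φ (f i) (if i ∈ T then 1 else 0)) s (0, q) =
      (∑ j ∈ s with j ∈ T, φ (word f {i ∈ s | j ≤ i} * q) • word f {i ∈ s | i < j},
        word f s * q) := by
  induction s using Finset.induction_on_min with
  | empty => simp
  | insert p s hp ih =>
    have hps : p ∉ s := fun h => (hp p h).false
    have h1 : ∀ j ∈ s, {i ∈ insert p s | j ≤ i} = {i ∈ s | j ≤ i} := fun j hj => by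
      rw [filter_insert, if_neg (not_le.2 (hp j hj))]
    have h2 : ∀ j ∈ s, word f {i ∈ insert p s | i < j} = f p * word f {i ∈ s | i < j} :=
      fun j hj => by
      rw [filter_insert, if_pos (hp j hj), word_insert _ fun q hq => hp q (mem_filter.1 hq).1]
    have h3 : {i ∈ insert p s | p ≤ i} = insert p s := filter_true_of_mem fun i hi => by
      rcases mem_insert.1 hi with rfl | hi
      exacts [le_rfl, (hp i hi).le]
    have h4 : {i ∈ insert p s | i < p} = ∅ := filter_false_of_mem fun i hi => by
      rcases mem_insert.1 hi with rfl | hi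
      exacts [lt_irrefl _, (hp i hi).not_gt]
    have h5 : ∑ j ∈ s with j ∈ T, φ (word f {i ∈ insert p s | j ≤ i} * q) •
        word f {i ∈ insert p s | i < j} =
        f p * ∑ j ∈ s with j ∈ T, φ (word f {i ∈ s | j ≤ i} * q) • word f {i ∈ s | i < j} := by
      rw [mul_sum]
      refine sum_congr rfl fun j hj => ?_
      rw [h1 j (mem_filter.1 hj).1, h2 j (mem_filter.1 hj).1, mul_smul_comm]
    rw [word_insert _ hp, mul_apply_eq_comp, ih, prependOp_apply, word_insert f hp,
      filter_insert (p := (· ∈ T))]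
    split_ifs with hpT
    · rw [sum_insert fun h => hps (mem_filter.1 h).1, h5, h3, h4, word_insert f hp]
      simp [mul_assoc, add_comm]
    · rw [h5]
      simp [mul_assoc]

theorem tendsto_pow_one_sub_prependOp {v : A} {c : ℂ} (h : ‖1 - c • v‖ < 1) (x : A × A) :
    Filter.Tendsto (fun n : ℕ => ((1 - c • prependOp φ v 1) ^ n) x) Filter.atTop (nhds 0) := by
  obtain ⟨r, hr, hr1⟩ := exists_between h
  have hr0 : 0 < r := (norm_nonneg _).trans_lt hr
  set T := 1 - c • prependOp φ v 1
  have hT : ∀ y : A × A, T y =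
      ((1 - c • v) * y.1 - (c * φ (v * y.2)) • 1, (1 - c • v) * y.2) := by
    intro y
    simp only [T, sub_apply, smul_apply,
      prependOp_apply, one_apply_eq_self, Prod.smul_mk, sub_mul, one_mul, smul_mul_assoc]
    ext
    · simp only [Prod.fst_sub, smul_add, smul_smul]
      abel
    · rfl
  have hsucc : ∀ n : ℕ, (T ^ (n + 1)) x = T ((T ^ n) x) := fun n => by rw [pow_succ']; rfl
  set K := ‖c‖ * (‖φ‖ * (‖v‖ * ‖x.2‖)) * ‖(1 : A)‖ / r with hK
  have hK0 : 0 ≤ K := by positivity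
  have h2 : ∀ n : ℕ, ‖((T ^ n) x).2‖ ≤ r ^ n * ‖x.2‖ := by
    intro n
    induction n with
    | zero => simp
    | succ n ih =>
      rw [hsucc, hT]
      refine (norm_mul_le _ _).trans ?_
      rw [pow_succ', mul_assoc]
      gcongr
  have h1 : ∀ n : ℕ, ‖((T ^ n) x).1‖ ≤ r ^ n * (‖x.1‖ + n * K) := by
    intro n
    induction n with
    | zero => simp
    | succ n ih =>
      rw [hsucc, hT]
      have e1 : ‖(1 - c • v) * ((T ^ n) x).1‖ ≤ r * (r ^ n * (‖x.1‖ + n * K)) :=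
        (norm_mul_le _ _).trans (by gcongr)
      have e2 : ‖(c * φ (v * ((T ^ n) x).2)) • (1 : A)‖ ≤ r ^ (n + 1) * K := by
        calc ‖(c * φ (v * ((T ^ n) x).2)) • (1 : A)‖
            = ‖c‖ * ‖φ (v * ((T ^ n) x).2)‖ * ‖(1 : A)‖ := by rw [norm_smul, norm_mul]
          _ ≤ ‖c‖ * (‖φ‖ * (‖v‖ * (r ^ n * ‖x.2‖))) * ‖(1 : A)‖ := by
            gcongr
            refine (φ.le_opNorm _).trans ?_
            gcongr
            refine (norm_mul_le _ _).trans ?_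
            gcongr
            exact h2 n
          _ = r ^ (n + 1) * K := by rw [hK, pow_succ]; field_simp
      refine (norm_sub_le _ _).trans ((add_le_add e1 e2).trans_eq ?_)
      push_cast
      ring
  have hpow := tendsto_pow_atTop_nhds_zero_of_lt_one hr0.le hr1
  have hnpow := tendsto_self_mul_const_pow_of_lt_one hr0.le hr1
  have l1 : Filter.Tendsto (fun n => ((T ^ n) x).1) Filter.atTop (nhds 0) := by
    refine squeeze_zero_norm h1 ?_
    have := (hpow.mul_const ‖x.1‖).add (hnpow.mul_const K)
    simp only [zero_mul, add_zero] at this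
    refine this.congr fun n => ?_
    ring
  have l2 : Filter.Tendsto (fun n => ((T ^ n) x).2) Filter.atTop (nhds 0) := by
    refine squeeze_zero_norm h2 ?_
    simpa using hpow.mul_const ‖x.2‖
  exact l1.prodMk_nhds l2

/-- A closed subspace that is invariant under prepending `v` is invariant under the inverse
operation when a multiple of `v` is close to `1`. -/
theorem mem_of_inverse_prependOp {v : A} {c : ℂ} (h : ‖1 - c • v‖ < 1)
    {N : Submodule ℂ (A × A)} (hN : IsClosed (N : Set (A × A)))
    (hinv : ∀ x ∈ N, prependOp φ v 1 x ∈ N) {J : A × A →L[ℂ] A × A}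
    (hJ : J * prependOp φ v 1 = 1) {x : A × A} (hx : x ∈ N) : J x ∈ N := by
  set S := prependOp φ v 1
  set T := 1 - c • S with hT
  have hTN : ∀ n, ∀ y ∈ N, (T ^ n) y ∈ N := by
    intro n
    induction n with
    | zero => simp
    | succ n ih =>
      intro y hy
      rw [pow_succ]
      exact ih _ (N.sub_mem hy (N.smul_mem c (hinv y hy)))
  have hsum : ∀ n, c • (∑ i ∈ range n, (T ^ i) x) = J (x - (T ^ n) x) := by
    intro n
    have h1 : (c • S) * ∑ i ∈ range n, T ^ i = 1 - T ^ n := by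
      rw [← mul_neg_geom_sum T n, hT, sub_sub_cancel]
    have h2 : (c • S) ((∑ i ∈ range n, T ^ i) x) = x - (T ^ n) x :=
      congrArg (fun L : A × A →L[ℂ] A × A => L x) h1
    have h3 : ∀ y, J (S y) = y := fun y => congrArg (fun L : A × A →L[ℂ] A × A => L y) hJ
    rw [← h2, smul_apply, map_smul, h3, _root_.sum_apply]
  have hlim : Filter.Tendsto (fun n => J (x - (T ^ n) x)) Filter.atTop (nhds (J x)) := by
    have := tendsto_const_nhds (x := x) |>.sub (tendsto_pow_one_sub_prependOp φ h x)
    rw [sub_zero] at this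
    exact (J.continuous.tendsto _).comp this
  refine hN.mem_of_tendsto hlim (Filter.Eventually.of_forall fun n => ?_)
  change J (x - (T ^ n) x) ∈ N
  rw [← hsum]
  exact N.smul_mem c (N.sum_mem fun i _ => hTN i x hx)

end Prepend

section ClosureWord

variable {M : Type*} [Monoid M]

theorem word_map_succ (f : ℕ → M) (t : Finset ℕ) :
    word f (t.map ⟨Nat.succ, Nat.succ_injective⟩) = word (fun i => f (i + 1)) t := by
  induction t using Finset.induction_on_min with
  | empty => simp
  | insert p t hp ih =>
    rw [map_insert, word_insert, ih, word_insert _ hp]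
    · rfl
    · intro q hq
      obtain ⟨r, hr, rfl⟩ := mem_map.1 hq
      exact Nat.succ_lt_succ (hp r hr)

theorem exists_word_of_mem_closure {x y w : M} (h : w ∈ Submonoid.closure {x, y}) :
    ∃ T t : Finset ℕ, (∀ q ∈ t, 0 < q) ∧ word (twoLetter T x y) t = w := by
  set e : ℕ ↪ ℕ := ⟨Nat.succ, Nat.succ_injective⟩
  have hcons : ∀ T t : Finset ℕ, (∀ q ∈ t, 0 < q) → ∀ S : Finset ℕ, S.erase 0 = T.erase 0 →
      word (twoLetter (S.map e) x y) ((insert 0 t).map e) =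
        twoLetter S x y 0 * word (twoLetter T x y) t := by
    intro T t ht S hS
    have hshift : ∀ i, twoLetter (S.map e) x y (i + 1) = twoLetter S x y i := fun i => by
      simp only [twoLetter]
      congr 1
      exact propext (mem_map' e)
    rw [word_map_succ]
    simp only [hshift]
    rw [word_insert _ ht]
    congr 1
    refine word_congr fun i hi => twoLetter_congr x y ?_
    have := congrArg (i ∈ ·) hS
    simpa [(ht i hi).ne'] using this
  have hpos : ∀ t : Finset ℕ, ∀ q ∈ t.map e, 0 < q := fun t q hq => by
    obtain ⟨r, -, rfl⟩ := mem_map.1 hq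
    exact r.succ_pos
  induction h using Submonoid.closure_induction_left with
  | one => exact ⟨∅, ∅, by simp, word_empty _⟩
  | mul_left c hc w _ ih =>
    obtain ⟨T, t, ht, rfl⟩ := ih
    rcases hc with rfl | rfl
    · refine ⟨(insert 0 T).map e, (insert 0 t).map e, hpos _, ?_⟩
      rw [hcons T t ht _ (by simp), twoLetter, if_pos (mem_insert_self _ _)]
    · refine ⟨(T.erase 0).map e, (insert 0 t).map e, hpos _, ?_⟩
      rw [hcons T t ht _ (by simp), twoLetter, if_neg (by simp)]

end ClosureWord

section Operators

variable {A : Type*} [NormedRing A] [NormedAlgebra ℂ A] (φ : A →L[ℂ] ℂ)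

/-- The inverse of `prependOp φ v 1`, where `v'` is the inverse of `v`. -/
def inversePrependOp (v' : A) : A × A →L[ℂ] A × A :=
  ((ContinuousLinearMap.mul ℂ A v').comp (.fst ℂ A A) -
    (φ.comp (.snd ℂ A A)).smulRight v').prod
    ((ContinuousLinearMap.mul ℂ A v').comp (.snd ℂ A A))

theorem inversePrependOp_apply (v' : A) (x : A × A) :
    inversePrependOp φ v' x = (v' * x.1 - φ x.2 • v', v' * x.2) := rfl

theorem inversePrependOp_mul_prependOp (v' c : A) :
    inversePrependOp φ v' * prependOp φ c 1 = prependOp φ (v' * c) 0 := by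
  ext x <;> simp [inversePrependOp_apply, mul_assoc]

theorem inversePrependOp_mul_prependOp_self {v v' : A} (h : v' * v = 1) :
    inversePrependOp φ v' * prependOp φ v 1 = 1 := by
  rw [inversePrependOp_mul_prependOp, h]
  ext x <;> simp

/-- The defect of the Schwinger–Dyson equation. -/
def defect (v : A) (τ a : ℂ) : A × A →L[ℂ] ℂ :=
  (φ.comp (ContinuousLinearMap.mul ℂ A v) - τ • φ).comp (.snd ℂ A A) -
    (a • φ).comp (.fst ℂ A A)

@[simp]
theorem defect_apply (v : A) (τ a : ℂ) (x : A × A) :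
    defect φ v τ a x = φ (v * x.2) - τ * φ x.2 - a * φ x.1 := rfl

/-- The vectors all of whose translates by a submonoid of operators lie in the kernel of `L`. -/
def orbitKernel (L : A × A →L[ℂ] ℂ) (S : Submonoid (A × A →L[ℂ] A × A)) :
    Submodule ℂ (A × A) where
  carrier := {x | ∀ w ∈ S, L (w x) = 0}
  add_mem' hx hy w hw := by rw [map_add, map_add, hx w hw, hy w hw, add_zero]
  zero_mem' w _ := by rw [map_zero, map_zero]
  smul_mem' c x hx w hw := by rw [map_smul, map_smul, hx w hw, smul_zero]

variable {L : A × A →L[ℂ] ℂ} {S : Submonoid (A × A →L[ℂ] A × A)}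

theorem isClosed_orbitKernel : IsClosed (orbitKernel L S : Set (A × A)) := by
  have : (orbitKernel L S : Set (A × A)) = ⋂ w ∈ S, {x | L (w x) = 0} := by
    ext x
    simp [orbitKernel]
  rw [this]
  exact isClosed_biInter fun w _ =>
    isClosed_eq (L.continuous.comp w.continuous) continuous_const

theorem apply_mem_orbitKernel {c : A × A →L[ℂ] A × A} (hc : c ∈ S) {x : A × A}
    (hx : x ∈ orbitKernel L S) : c x ∈ orbitKernel L S :=
  fun w hw => hx (w * c) (S.mul_mem hw hc)

theorem word_apply_mem {N : Submodule ℂ (A × A)} {g : ℕ → A × A →L[ℂ] A × A}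
    (h : ∀ i, ∀ x ∈ N, g i x ∈ N) (s : Finset ℕ) : ∀ x ∈ N, word g s x ∈ N := by
  induction s using Finset.induction_on_min with
  | empty => simp
  | insert p s hp ih =>
    intro x hx
    rw [word_insert g hp]
    exact h p _ (ih x hx)

/-- The Schwinger–Dyson equation passes from words in `x, y` to words in `x + y` and
`(x + y)⁻¹ x`. -/
theorem defect_word_eq_zero {x y v' : A} {τ a c : ℂ}
    (hSD : ∀ T t : Finset ℕ, (∀ q ∈ t, 0 < q) →
      φ ((x + y) * word (twoLetter T x y) t) = τ * φ (word (twoLetter T x y) t) +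
      a * ∑ q ∈ t, φ (word (twoLetter T x y) {i ∈ t | i < q}) *
        φ (word (twoLetter T x y) {i ∈ t | q ≤ i}))
    (hv : v' * (x + y) = 1) (hc : ‖1 - c • (x + y)‖ < 1) (T r s : Finset ℕ) :
    defect φ (x + y) τ a
      (word (fun i => prependOp φ (twoLetter T (x + y) (v' * x) i) (if i ∈ T then 1 else 0)) r
        (word (fun i => prependOp φ (twoLetter T (x + y) (v' * x) i) (if i ∈ T then 1 else 0)) s
          (0, 1))) = 0 := by
  set v := x + y with hvxy
  set S : Submonoid (A × A →L[ℂ] A × A) :=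
    Submonoid.closure {prependOp φ x 1, prependOp φ y 1} with hS
  set N := orbitKernel (defect φ v τ a) S with hN
  have hx : ∀ u ∈ N, prependOp φ x 1 u ∈ N := fun u hu =>
    apply_mem_orbitKernel (Submonoid.subset_closure (by simp)) hu
  have hy : ∀ u ∈ N, prependOp φ y 1 u ∈ N := fun u hu =>
    apply_mem_orbitKernel (Submonoid.subset_closure (by simp)) hu
  have hadd : ∀ u ∈ N, prependOp φ v 1 u ∈ N := fun u hu => by
    have : prependOp φ v 1 u = prependOp φ x 1 u + prependOp φ y 1 u := by
      ext
      · simp [hvxy, add_mul, add_smul]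
        abel
      · simp [hvxy, add_mul]
    rw [this]
    exact N.add_mem (hx u hu) (hy u hu)
  have hz : ∀ u ∈ N, prependOp φ (v' * x) 0 u ∈ N := fun u hu => by
    rw [← inversePrependOp_mul_prependOp]
    exact mem_of_inverse_prependOp φ hc isClosed_orbitKernel hadd
      (inversePrependOp_mul_prependOp_self φ hv) (hx u hu)
  have hstart : ((0, 1) : A × A) ∈ N := by
    intro w hw
    obtain ⟨T, t, ht, rfl⟩ := exists_word_of_mem_closure hw
    have : word (twoLetter T (prependOp φ x 1) (prependOp φ y 1)) t =
        word (fun i => prependOp φ (twoLetter T x y i) (if i ∈ t then 1 else 0)) t :=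
      word_congr fun i hi => by
        rw [if_pos hi, twoLetter, twoLetter]
        split_ifs <;> rfl
    rw [this, word_prependOp, filter_true_of_mem fun _ h => h, defect_apply, mul_one, hSD T t ht,
      map_sum]
    simp [mul_comm]
  have hstep : ∀ i, ∀ u ∈ N,
      prependOp φ (twoLetter T v (v' * x) i) (if i ∈ T then 1 else 0) u ∈ N := by
    intro i u hu
    rw [twoLetter]
    split_ifs
    exacts [hadd u hu, hz u hu]
  exact word_apply_mem hstep r _ (word_apply_mem hstep s _ hstart) 1 S.one_mem

theorem tracial_recursion {v z : A} {τ a : ℂ} {T : Finset ℕ}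
    (htr : ∀ b c, φ (b * c) = φ (c * b))
    (hdef : ∀ r s : Finset ℕ, defect φ v τ a
      (word (fun i => prependOp φ (twoLetter T v z i) (if i ∈ T then 1 else 0)) r
        (word (fun i => prependOp φ (twoLetter T v z i) (if i ∈ T then 1 else 0)) s
          (0, 1))) = 0)
    {s : Finset ℕ} {p : ℕ} (hp : p ∈ s) (hpT : p ∈ T) (hmin : ∀ x ∈ s, x < p → x ∉ T) :
    φ (word (twoLetter T v z) s) = τ * φ (word (twoLetter T v z) (s.erase p)) +
      a * ∑ q ∈ s with q ∈ T ∧ p < q, φ (word (twoLetter T v z) {x ∈ s | p < x ∧ x < q}) *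
        φ (word (twoLetter T v z) {x ∈ s | ¬(p ≤ x ∧ x < q)}) := by
  set f := twoLetter T v z with hf
  set l : Finset ℕ := {x ∈ s | x < p} with hl
  set r : Finset ℕ := {x ∈ s | p < x} with hr
  have hlr : ∀ t ⊆ r, ∀ i ∈ l, ∀ j ∈ t, i < j := fun t ht i hi j hj =>
    (mem_filter.1 hi).2.trans (mem_filter.1 (ht hj)).2
  have hpr : ∀ j ∈ r, p < j := fun j hj => (mem_filter.1 hj).2
  have hs : s = l ∪ insert p r := by
    ext x
    simp only [hl, hr, mem_union, mem_insert, mem_filter]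
    constructor
    · intro hx
      rcases lt_trichotomy x p with h | h | h <;> simp [hx, h]
    · rintro (h | rfl | h)
      exacts [h.1, hp, h.1]
  have hse : s.erase p = l ∪ r := by
    ext x
    simp only [hl, hr, mem_union, mem_filter, mem_erase]
    constructor
    · rintro ⟨h, hx⟩
      rcases lt_or_gt_of_ne h with h | h <;> simp [hx, h]
    · rintro (h | h)
      exacts [⟨h.2.ne, h.1⟩, ⟨h.2.ne', h.1⟩]
  have hls : ∀ i ∈ l, ∀ j ∈ insert p r, i < j := by
    intro i hi j hj
    rcases mem_insert.1 hj with rfl | hj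
    exacts [(mem_filter.1 hi).2, hlr r subset_rfl i hi j hj]
  have hfp : f p = v := if_pos hpT
  have h1 : φ (word f s) = φ (v * (word f r * word f l)) := by
    rw [hs, word_union f hls, word_insert f hpr, hfp, htr, mul_assoc]
  have h2 : φ (word f (s.erase p)) = φ (word f r * word f l) := by
    rw [hse, word_union f (hlr r subset_rfl), htr]
  have h3 := hdef r l
  have hnil : {j ∈ l | j ∈ T} = ∅ := filter_false_of_mem fun j hj =>
    hmin j (mem_filter.1 hj).1 (mem_filter.1 hj).2
  rw [word_prependOp, hnil, sum_empty, mul_one, word_prependOp, defect_apply, map_sum,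
    sub_sub, sub_eq_zero] at h3
  rw [h1, h2, h3]
  congr 2
  have hidx : {j ∈ r | j ∈ T} = {q ∈ s | q ∈ T ∧ p < q} := by
    ext q
    simp only [hr, mem_filter]
    tauto
  rw [hidx]
  refine sum_congr rfl fun q hq => ?_
  have hpq := (mem_filter.1 hq).2.2
  have e1 : {i ∈ r | i < q} = {x ∈ s | p < x ∧ x < q} := by rw [hr, filter_filter]
  have e2 : {x ∈ s | ¬(p ≤ x ∧ x < q)} = l ∪ {i ∈ r | q ≤ i} := by
    ext x
    simp only [hl, hr, mem_union, mem_filter]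
    constructor
    · rintro ⟨hx, h⟩
      by_cases hxp : x < p
      · exact Or.inl ⟨hx, hxp⟩
      · exact Or.inr ⟨⟨hx, by omega⟩, by omega⟩
    · rintro (⟨hx, h⟩ | ⟨⟨hx, h⟩, h'⟩)
      exacts [⟨hx, by omega⟩, ⟨hx, by omega⟩]
  rw [map_smul, smul_eq_mul, e1, e2, word_union f (hlr _ (filter_subset _ _)), htr, mul_comm]

end Operators

/-- Weights whose non-crossing sums satisfy the Schwinger–Dyson recursion at the first point of
`T` are geometric on subsets of `T` and vanish on sets meeting `T` and its complement. -/
theorem eq_of_recursion {k : Finset ℕ → ℂ} {θ a : ℂ} {T : Finset ℕ}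
    (h : ∀ (s : Finset ℕ) (p : ℕ), p ∈ s → p ∈ T → (∀ x ∈ s, x < p → x ∉ T) →
      ncSum k s = θ * a * ncSum k (s.erase p) +
        a * ∑ q ∈ s with q ∈ T ∧ p < q,
          ncSum k {x ∈ s | p < x ∧ x < q} * ncSum k {x ∈ s | ¬(p ≤ x ∧ x < q)})
    {s : Finset ℕ} (hs : s.Nonempty) :
    k s = if s ⊆ T then θ * a ^ #s else if Disjoint s T then k s else 0 := by
  set k' : Finset ℕ → ℂ :=
    fun s => if s ⊆ T then θ * a ^ #s else if Disjoint s T then k s else 0 with hk'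
  refine eq_of_ncSum_eq (k' := k') hs fun t hts => ?_
  clear hts
  have hmixed : ∀ {B : Finset ℕ} {q : ℕ}, q ∈ B → q ∈ T → ¬B ⊆ T → k' B = 0 := by
    intro B q hq hqT hB
    simp only [hk']
    rw [if_neg hB, if_neg fun hd => disjoint_left.1 hd hq hqT]
  have hpure : ∀ {B : Finset ℕ}, B ⊆ T → k' B = θ * a ^ #B := fun hB => if_pos hB
  induction t using Finset.strongInduction with
  | H t ih =>
    by_cases hd : Disjoint t T
    · refine ncSum_congr fun B hB hne => ?_
      obtain ⟨i, hi⟩ := hne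
      simp only [hk']
      rw [if_neg fun hBT => disjoint_left.1 hd (hB hi) (hBT hi), if_pos (hd.mono_left hB)]
    · obtain ⟨p, hp, hpT, hmin⟩ : ∃ p ∈ t, p ∈ T ∧ ∀ x ∈ t, x ∈ T → p ≤ x := by
        obtain ⟨i, hi, hiT⟩ := not_disjoint_iff.1 hd
        obtain ⟨p, hp, hmin⟩ :=
          exists_min_image {x ∈ t | x ∈ T} id ⟨i, mem_filter.2 ⟨hi, hiT⟩⟩
        obtain ⟨hp, hpT⟩ := mem_filter.1 hp
        exact ⟨p, hp, hpT, fun x hx hxT => hmin x (mem_filter.2 ⟨hx, hxT⟩)⟩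
      rw [h t p hp hpT fun x hx hlt hxT => (hmin x hx hxT).not_gt hlt,
        ncSum_eq_recursion k' (T := T) (a := a) hp, hpure (singleton_subset_iff.2 hpT),
        ih _ (erase_ssubset hp)]
      · congr 1
        · simp
        · congr 1
          refine sum_congr rfl fun q hq => ?_
          have hpq := (mem_filter.1 hq).2.2
          rw [ih _ (filter_ssubset.2 ⟨p, hp, by simp⟩),
            ih _ (filter_ssubset.2 ⟨p, hp, by simp [hpq]⟩)]
      · intro q _ hqT hpq B _ hqB hav
        have hpB : p ∉ B := fun h => hav p h ⟨le_rfl, hpq⟩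
        by_cases hBT : B ⊆ T
        · rw [hpure hBT, hpure (insert_subset hpT hBT), card_insert_of_notMem hpB]
          ring
        · rw [hmixed hqB hqT hBT, mul_zero]
          exact hmixed (mem_insert_of_mem hqB) hqT fun h => hBT ((subset_insert p B).trans h)
      · intro B hB hpB hBp hk0
        have hBT : B ⊆ T := by
          by_contra hBT
          exact hk0 (hmixed hpB hpT hBT)
        have hne' : (B.erase p).Nonempty := by
          rw [nonempty_iff_ne_empty]
          exact fun h => hBp ((erase_eq_empty_iff B p).1 h |>.resolve_left (ne_empty_of_mem hpB))
        obtain ⟨hqp, hqB⟩ := mem_erase.1 (min'_mem _ hne')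
        refine ⟨_, hqB, hBT hqB, lt_of_le_of_ne (hmin _ (hB hqB) (hBT hqB)) (Ne.symm hqp),
          fun x hx h => ?_⟩
        exact absurd h.2 (not_lt.2 (min'_le _ x (mem_erase.2 ⟨h.1.ne', hx⟩)))

/-- Words are conjugated when their letters are. -/
theorem word_conj {A : Type*} [Monoid A] {f g : ℕ → A} {w w' : A} (h : w * w' = 1)
    (h' : w' * w = 1) (hfg : ∀ i, f i = w' * g i * w) (s : Finset ℕ) :
    word f s = w' * word g s * w := by
  induction s using Finset.induction_on_min with
  | empty => simp [h']
  | insert p s hp ih =>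
    rw [word_insert f hp, word_insert g hp, ih, hfg]
    calc w' * g p * w * (w' * word g s * w) = w' * g p * (w * w') * word g s * w := by
          simp only [mul_assoc]
      _ = _ := by rw [h]; simp only [mul_assoc, one_mul]

/-- Two elements are free as soon as the cumulants of their mixed words are those of a pair
of free elements of which one is free Poisson. -/
theorem freeElems_of_setCum {A : Type*} {R : ∀ n, (Fin n → A) → ℂ} {u v : A} {θ a : ℂ}
    (hθ : θ ≠ 0) (ha : a ≠ 0)
    (h : ∀ T s : Finset ℕ, s.Nonempty → setCum R (twoLetter T v u) s =
      if s ⊆ T then θ * a ^ #s else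
        if Disjoint s T then setCum R (twoLetter T v u) s else 0) : FreeElems R u v := by
  have hne : u ≠ v := by
    rintro rfl
    have h1 := h {0} {0, 1} (by simp)
    have h2 := h {0, 1} {0, 1} (by simp)
    rw [if_pos subset_rfl] at h2
    rw [if_neg (by simp [subset_iff]), if_neg (by simp)] at h1
    have : setCum R (twoLetter {0} u u) {0, 1} = setCum R (twoLetter {0, 1} u u) {0, 1} :=
      setCum_congr R fun i _ => by simp [twoLetter]
    rw [h1, h2] at this
    exact mul_ne_zero hθ (pow_ne_zero _ ha) this.symm
  intro n f hf ⟨i, hi⟩ ⟨j, hj⟩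
  set F : ℕ → A := fun m => if hm : m < n then f ⟨m, hm⟩ else u
  have hF : ∀ m : Fin n, F m = f m := fun m => dif_pos m.isLt
  set T : Finset ℕ := {m ∈ range n | F m = v} with hT
  have hR : R n f = setCum R (twoLetter T v u) (range n) := by
    have : R n f = setCum R F (range n) := by
      rw [setCum_range]
      exact congrArg (R n) (funext fun m => (hF m).symm)
    rw [this]
    refine setCum_congr R fun m hm => ?_
    rw [twoLetter]
    split_ifs with hmT
    · exact (mem_filter.1 hmT).2
    · have hmv : F m ≠ v := fun h => hmT (mem_filter.2 ⟨hm, h⟩)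
      have := hf ⟨m, mem_range.1 hm⟩
      rw [← hF] at this
      exact this.resolve_right hmv
  rw [hR, h T _ ⟨i, mem_range.2 i.isLt⟩, if_neg, if_neg]
  · refine not_disjoint_iff.2 ⟨j, mem_range.2 j.isLt, mem_filter.2 ⟨mem_range.2 j.isLt, ?_⟩⟩
    rw [hF]
    exact hj
  · intro hsub
    have := (mem_filter.1 (hsub (mem_range.2 i.isLt))).2
    rw [hF] at this
    exact hne (hi.symm.trans this)

/-- free Lukacs property, the main theorem: in a C*-probability space with a
faithful tracial state, if `X, Y` are free and free Poisson distributed with parameters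
`(l, a)` and `(k, a)` with `l + k > 1`, then `U = (X+Y)^{-1/2} X (X+Y)^{-1/2}` and `V = X + Y`
are free. Here `w` is the self-adjoint element playing the role of `(X+Y)^{-1/2}`. -/
theorem free_lukacs
    {A : Type*} [NormedRing A] [StarRing A] [CStarRing A] [CompleteSpace A]
    [NormedAlgebra ℂ A] [StarModule ℂ A]
    (φ : A →ₗ[ℂ] ℂ) (R : ∀ n, (Fin n → A) → ℂ)
    (hst : IsState φ) (hfa : Faithful φ) (htr : Tracial φ)
    (hmc : MomentCumulant (⇑φ) R)
    (X Y : A) (hXsa : IsSelfAdjoint X) (hYsa : IsSelfAdjoint Y)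
    (l k a : ℝ) (hl : 0 ≤ l) (hk : 0 ≤ k) (ha : 0 < a) (hlk : 1 < l + k)
    (hmomX : HasMoments (⇑φ) X (freePoissonMeasure l a))
    (hmomY : HasMoments (⇑φ) Y (freePoissonMeasure k a))
    (hfree : FreeElems R X Y)
    (w : A) (hwsa : IsSelfAdjoint w)
    (hw : w * w * (X + Y) = 1) (hwc : w * (X + Y) = (X + Y) * w) :
    FreeElems R (w * X * w) (X + Y) := by
  set θ : ℂ := l + k with hθ
  have hθ0 : θ ≠ 0 := by
    rw [hθ]
    exact_mod_cast (zero_lt_one.trans hlk).ne'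
  have ha0 : (a : ℂ) ≠ 0 := by exact_mod_cast ha.ne'
  set v := X + Y with hv
  have hwv : w * (w * v) = 1 := by rw [← mul_assoc, hw]
  have hvw : w * v * w = 1 := by rw [mul_assoc, ← hwc, hwv]
  have hvsa : IsSelfAdjoint v := hXsa.add hYsa
  have hsq : w * v * (w * v) = v := by
    rw [← mul_assoc, hvw, one_mul]
  have husa : IsSelfAdjoint (w * v) := by
    rw [isSelfAdjoint_iff, star_mul, hwsa.star_eq, hvsa.star_eq, hwc]
  have hunit : IsUnit (w * v * (w * v)) :=
    have : IsUnit (w * v) := ⟨⟨w * v, w, hvw, hwv⟩, rfl⟩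
    this.mul this
  obtain ⟨c, -, hc⟩ := exists_norm_one_sub_smul_lt husa hunit
  rw [hsq] at hc
  set ψ : A →L[ℂ] ℂ := ⟨φ, hst.continuous⟩
  set z := w * w * X with hz
  have hdef := fun T => defect_word_eq_zero ψ (τ := θ * a) (a := a) (T := T)
    (fun T t ht => schwingerDyson_add hmc hfree
      (fun _ => setCum_freePoisson hmc hst.1 hl ha hmomX)
      (fun _ => setCum_freePoisson hmc hst.1 hk ha hmomY) ht) hw hc
  have hword : ∀ T s : Finset ℕ, φ (word (twoLetter T v z) s) =
      ncSum (setCum R (twoLetter T v (w * X * w))) s := by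
    intro T s
    have hconj : ∀ i, twoLetter T v (w * X * w) i = w * v * twoLetter T v z i * w := by
      intro i
      rw [twoLetter, twoLetter]
      split_ifs
      · rw [mul_assoc, ← hwc, hsq]
      · rw [hz, ← mul_assoc, ← mul_assoc, hvw, one_mul]
    rw [← hmc.word, word_conj hwv hvw hconj, htr, ← mul_assoc, hwv, one_mul]
  refine freeElems_of_setCum hθ0 ha0 fun T s hs => eq_of_recursion (fun s p hp hpT hmin => ?_) hs
  simp only [← hword]
  exact tracial_recursion ψ htr (hdef T) hp hpT hmin

end FreeProbLukacs
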